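/- Let s ∈ (1,2], 1 < p < ∞ and T > 0. There is a constant C = C(s,p,T) such that for every real Banach space X having type s with constant T, every n ∈ ℕ, and every F : {-1,1}^n × {-1,1}^n → X, setting F_j(ε) := E_δ[δ_j F(ε,δ)] for j = 1,…,n, one has (E_ε‖Σ_{j=1}^n Δ^{-1} D_j F_j‖_X^p)^{1/p} ≤ C · (E_{δ,ε}‖F(ε,δ)‖_X^p)^{1/p}; in particular the constant is independent of n. -/

import Mathlib

open scoped BigOperators
open Finset

noncomputable section

/-- The ±1 value of a Boolean coordinate. -/
def rad (b : Bool) : ℝ := if b then 1 else -1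

/-- Expectation over the uniform measure on the discrete cube `{-1,1}^n`
(points encoded as `Fin n → Bool`). -/
def cubeAvg {n : ℕ} {X : Type*} [AddCommGroup X] [Module ℝ X]
    (f : (Fin n → Bool) → X) : X :=
  ((2 ^ n : ℝ)⁻¹) • ∑ ε : Fin n → Bool, f ε

/-- Walsh character `w_A(ε) = ∏_{i ∈ A} ε_i`. -/
def walshChar {n : ℕ} (A : Finset (Fin n)) (ε : Fin n → Bool) : ℝ :=
  ∏ i ∈ A, rad (ε i)

/-- Walsh coefficient `f̂(A) = E_ε [f(ε) w_A(ε)]`. -/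
def wcoef {n : ℕ} {X : Type*} [AddCommGroup X] [Module ℝ X]
    (f : (Fin n → Bool) → X) (A : Finset (Fin n)) : X :=
  cubeAvg (fun ε => walshChar A ε • f ε)

/-- Flip the `j`-th coordinate. -/
def flipCoord {n : ℕ} (j : Fin n) (ε : Fin n → Bool) : Fin n → Bool :=
  Function.update ε j (!(ε j))

/-- Discrete derivative `D_j f(ε) = (f(ε) - f(σ_j ε))/2`. -/
def Dop {n : ℕ} {X : Type*} [AddCommGroup X] [Module ℝ X]
    (j : Fin n) (f : (Fin n → Bool) → X) : (Fin n → Bool) → X :=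
  fun ε => (2 : ℝ)⁻¹ • (f ε - f (flipCoord j ε))

/-- Heat semigroup `P_t f = Σ_A e^{-t|A|} f̂(A) w_A`. -/
def heatOp {n : ℕ} {X : Type*} [AddCommGroup X] [Module ℝ X]
    (t : ℝ) (f : (Fin n → Bool) → X) : (Fin n → Bool) → X :=
  fun ε => ∑ A : Finset (Fin n), (Real.exp (-t * A.card) * walshChar A ε) • wcoef f A

/-- Fractional power of the Laplacian on mean-zero parts:
`Δ^a f = Σ_{A ≠ ∅} |A|^a f̂(A) w_A`. -/
def lapPow {n : ℕ} {X : Type*} [AddCommGroup X] [Module ℝ X]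
    (a : ℝ) (f : (Fin n → Bool) → X) : (Fin n → Bool) → X :=
  fun ε => ∑ A ∈ Finset.univ.filter (fun A : Finset (Fin n) => A ≠ ∅),
    (((A.card : ℝ)) ^ a * walshChar A ε) • wcoef f A

/-- `X` has cotype `q` with constant `K`. -/
def HasCotypeConst (X : Type*) [NormedAddCommGroup X] [NormedSpace ℝ X] (q K : ℝ) : Prop :=
  ∀ m : ℕ, ∀ x : Fin m → X,
    (∑ j, ‖x j‖ ^ q) ^ (1 / q) ≤
      K * (cubeAvg (fun δ : Fin m → Bool => ‖∑ j, rad (δ j) • x j‖ ^ (2 : ℝ))) ^ (1 / 2 : ℝ)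

/-- `X` has type `s` with constant `T`. -/
def HasTypeConst (X : Type*) [NormedAddCommGroup X] [NormedSpace ℝ X] (s T : ℝ) : Prop :=
  ∀ m : ℕ, ∀ x : Fin m → X,
    (cubeAvg (fun δ : Fin m → Bool => ‖∑ j, rad (δ j) • x j‖ ^ (2 : ℝ))) ^ (1 / 2 : ℝ) ≤
      T * (∑ j, ‖x j‖ ^ s) ^ (1 / s)

section AbstractK

variable {𝒜 : Type*} [NormedRing 𝒜] [NormedAlgebra ℝ 𝒜] [CompleteSpace 𝒜]

open MeasureTheory in
/-- Integral (Minkowski) bound for multipliers. -/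
lemma kc_integral (Φ : (ℕ → ℝ) →ₐ[ℝ] 𝒜) (N : ℕ) (R : ℕ → 𝒜)
    (hΦ : ∀ m, Φ m = ∑ k ∈ range N, m k • R k)
    {α : Type*} [MeasurableSpace α] (μ : Measure α) (m : α → ℕ → ℝ) (g : α → ℝ)
    (hm : ∀ k, Integrable (fun u => m u k) μ) (hg : Integrable g μ)
    (hle : ∀ᵐ u ∂μ, ‖Φ (m u)‖ ≤ g u) :
    ‖Φ (fun k => ∫ u, m u k ∂μ)‖ ≤ ∫ u, g u ∂μ := by
  have h : Φ (fun k => ∫ u, m u k ∂μ) = ∫ u, Φ (m u) ∂μ := by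
    simp only [hΦ]
    rw [integral_finsetSum]
    · refine Finset.sum_congr rfl fun k _ => ?_
      rw [integral_smul_const]
    · intro k _
      exact (hm k).smul_const _
  rw [h]
  exact norm_integral_le_of_norm_le hg hle

lemma kc_tsum (Φ : (ℕ → ℝ) →ₐ[ℝ] 𝒜) (N : ℕ) (R : ℕ → 𝒜)
    (hΦ : ∀ m, Φ m = ∑ k ∈ range N, m k • R k)
    (m : ℕ → ℕ → ℝ) (M : ℕ → ℝ) (g : ℕ → ℝ) (G : ℝ)
    (hm : ∀ k, HasSum (fun j => m j k) (M k)) (hg : HasSum g G)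
    (hle : ∀ j, ‖Φ (m j)‖ ≤ g j) : ‖Φ M‖ ≤ G := by
  have h : HasSum (fun j => Φ (m j)) (Φ M) := by
    simp only [hΦ]
    exact hasSum_sum fun k _ => (hm k).smul_const _
  exact h.norm_le_of_bounded hg hle

lemma kc_inv (Φ : (ℕ → ℝ) →ₐ[ℝ] 𝒜) (M : ℕ)
    (h1 : ∀ ρ : ℝ, 0 ≤ ρ → ρ ≤ 1 → ‖Φ (fun k => ρ ^ k)‖ ≤ 1)
    (h2 : ∀ ρ : ℝ, 0 ≤ ρ → ρ ≤ 1 → ‖Φ (fun k => (1 - ρ ^ k) ^ M)‖ ≤ 3 / 4 * 2 ^ M)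
    (ρ : ℝ) (h0 : 0 ≤ ρ) (hρ : ρ ≤ 1) :
    ‖Φ (fun k => (1 + ρ ^ k)⁻¹)‖ ≤ 2 * M := by
  set v : ℕ → ℝ := fun k => (1 + ρ ^ k)⁻¹ with hv
  set w : ℕ → ℝ := fun k => (1 - ρ ^ k) / 2 with hw
  have hone : ‖(1 : 𝒜)‖ ≤ 1 := by
    have := h1 1 zero_le_one le_rfl
    have e : (fun k : ℕ => (1 : ℝ) ^ k) = 1 := by ext k; simp
    rwa [e, map_one] at this
  have hwn : ‖Φ w‖ ≤ 1 := by
    have e : w = (2 : ℝ)⁻¹ • ((1 : ℕ → ℝ) - fun k => ρ ^ k) := by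
      ext k; simp [hw]; ring
    rw [e, map_smul, map_sub, map_one, norm_smul]
    have := norm_sub_le (1 : 𝒜) (Φ fun k => ρ ^ k)
    have := h1 ρ h0 hρ
    rw [Real.norm_of_nonneg (by norm_num)]
    linarith
  have hpow : ∀ j : ℕ, ‖Φ (w ^ j)‖ ≤ 1 := by
    intro j
    induction j with
    | zero => simpa using hone
    | succ j ih =>
      rw [pow_succ, map_mul]
      exact (norm_mul_le _ _).trans (mul_le_one₀ ih (norm_nonneg _) hwn)
  have hwM : ‖Φ (w ^ M)‖ ≤ 3 / 4 := by
    have e : w ^ M = ((2 : ℝ) ^ M)⁻¹ • (fun k => (1 - ρ ^ k) ^ M) := by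
      ext k; simp [hw, div_pow]; field_simp
    rw [e, map_smul, norm_smul, Real.norm_of_nonneg (by positivity)]
    have := h2 ρ h0 hρ
    rw [inv_mul_le_iff₀ (by positivity)]
    linarith
  have hid : v = (2 : ℝ)⁻¹ • (∑ j ∈ range M, w ^ j) + w ^ M * v := by
    ext k
    have hx : 0 ≤ ρ ^ k := by positivity
    have hg := geom_sum_mul_neg (w k) M
    have e1 : 1 - w k = (1 + ρ ^ k) / 2 := by simp [hw]; ring
    rw [e1] at hg
    simp only [Pi.add_apply, Pi.smul_apply, Finset.sum_apply, Pi.pow_apply, Pi.mul_apply,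
      smul_eq_mul, hv]
    have hne : (1 + ρ ^ k) ≠ 0 := by positivity
    field_simp
    linarith
  have hV : ‖Φ v‖ ≤ M / 2 + 3 / 4 * ‖Φ v‖ := by
    conv_lhs => rw [hid]
    rw [map_add, map_smul, map_sum, map_mul]
    refine (norm_add_le _ _).trans (add_le_add ?_ ?_)
    · rw [norm_smul, Real.norm_of_nonneg (by norm_num)]
      have : ‖∑ j ∈ range M, Φ (w ^ j)‖ ≤ M := by
        refine (norm_sum_le _ _).trans ?_
        refine (Finset.sum_le_sum fun j _ => hpow j).trans ?_
        simp
      linarith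
    · refine (norm_mul_le _ _).trans ?_
      gcongr
  linarith

lemma kc_scal_sin (k y : ℝ) (hy : 0 < y) :
    ∫ u in (0:ℝ)..(Real.pi / y), Real.sin (y * u) * Real.exp (-k * u) =
      y / (k ^ 2 + y ^ 2) * (1 + Real.exp (-k * (Real.pi / y))) := by
  have hne : k ^ 2 + y ^ 2 ≠ 0 := by positivity
  have hd : ∀ u : ℝ, HasDerivAt (fun u => -(k * Real.sin (y * u) + y * Real.cos (y * u)) *
      Real.exp (-k * u) / (k ^ 2 + y ^ 2)) (Real.sin (y * u) * Real.exp (-k * u)) u := by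
    intro u
    have h1 : HasDerivAt (fun u : ℝ => y * u) y u := by simpa using (hasDerivAt_id u).const_mul y
    have h2 : HasDerivAt (fun u : ℝ => -k * u) (-k) u := by
      simpa using (hasDerivAt_id u).const_mul (-k)
    have := ((((h1.sin.const_mul k).add (h1.cos.const_mul y)).neg.mul h2.exp).div_const
      (k ^ 2 + y ^ 2))
    convert! this using 1
    simp only [Pi.add_apply, Pi.neg_apply]
    field_simp
    ring
  rw [intervalIntegral.integral_eq_sub_of_hasDerivAt (fun u _ => hd u)
    (Continuous.intervalIntegrable (by fun_prop) _ _)]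
  have : y * (Real.pi / y) = Real.pi := by field_simp
  rw [this]
  simp
  field_simp
  ring

lemma kc_scal_cos (k y : ℝ) (hy : 0 < y) :
    ∫ u in (0:ℝ)..(Real.pi / y), Real.cos (y * u) * Real.exp (-k * u) =
      k / (k ^ 2 + y ^ 2) * (1 + Real.exp (-k * (Real.pi / y))) := by
  have hne : k ^ 2 + y ^ 2 ≠ 0 := by positivity
  have hd : ∀ u : ℝ, HasDerivAt (fun u => (y * Real.sin (y * u) - k * Real.cos (y * u)) *
      Real.exp (-k * u) / (k ^ 2 + y ^ 2)) (Real.cos (y * u) * Real.exp (-k * u)) u := by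
    intro u
    have h1 : HasDerivAt (fun u : ℝ => y * u) y u := by simpa using (hasDerivAt_id u).const_mul y
    have h2 : HasDerivAt (fun u : ℝ => -k * u) (-k) u := by
      simpa using (hasDerivAt_id u).const_mul (-k)
    have := ((((h1.sin.const_mul y).sub (h1.cos.const_mul k)).mul h2.exp).div_const
      (k ^ 2 + y ^ 2))
    convert! this using 1
    simp only [Pi.sub_apply]
    field_simp
    ring
  rw [intervalIntegral.integral_eq_sub_of_hasDerivAt (fun u _ => hd u)
    (Continuous.intervalIntegrable (by fun_prop) _ _)]
  have : y * (Real.pi / y) = Real.pi := by field_simp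
  rw [this]
  simp
  field_simp
  ring

lemma kc_exp_norm (Φ : (ℕ → ℝ) →ₐ[ℝ] 𝒜)
    (h1 : ∀ ρ : ℝ, 0 ≤ ρ → ρ ≤ 1 → ‖Φ (fun k => ρ ^ k)‖ ≤ 1) (u : ℝ) (hu : 0 ≤ u) :
    ‖Φ (fun k => Real.exp (-k * u))‖ ≤ 1 := by
  have := h1 (Real.exp (-u)) (Real.exp_pos _).le (Real.exp_le_one_iff.2 (by linarith))
  convert this using 4 with k
  rw [← Real.exp_nat_mul]; congr 1; ring

/-- Resolvent bounds on the imaginary axis. -/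
lemma kc_resolvent (Φ : (ℕ → ℝ) →ₐ[ℝ] 𝒜) (N : ℕ) (R : ℕ → 𝒜)
    (hΦ : ∀ m, Φ m = ∑ k ∈ range N, m k • R k) (M : ℕ)
    (h1 : ∀ ρ : ℝ, 0 ≤ ρ → ρ ≤ 1 → ‖Φ (fun k => ρ ^ k)‖ ≤ 1)
    (h2 : ∀ ρ : ℝ, 0 ≤ ρ → ρ ≤ 1 → ‖Φ (fun k => (1 - ρ ^ k) ^ M)‖ ≤ 3 / 4 * 2 ^ M)
    (y : ℝ) (hy : 0 < y) :
    ‖Φ (fun k => y / ((k:ℝ) ^ 2 + y ^ 2))‖ ≤ 2 * M * Real.pi / y ∧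
    ‖Φ (fun k => k / ((k:ℝ) ^ 2 + y ^ 2))‖ ≤ 2 * M * Real.pi / y := by
  have hpy : 0 < Real.pi / y := div_pos Real.pi_pos hy
  have hinv := kc_inv Φ M h1 h2 (Real.exp (-(Real.pi / y))) (Real.exp_pos _).le
    (Real.exp_le_one_iff.2 (by linarith))
  have key : ∀ (tr : ℝ → ℝ) (c : ℕ → ℝ), Continuous tr → (∀ x, |tr x| ≤ 1) →
      (∀ k : ℕ, ∫ u in (0:ℝ)..(Real.pi / y), tr (y * u) * Real.exp (-k * u) =
        c k * (1 + Real.exp (-k * (Real.pi / y)))) → ‖Φ c‖ ≤ 2 * M * Real.pi / y := by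
    intro tr c htr hb hinteg
    have hI : ‖Φ (fun k => ∫ u in Set.Ioc 0 (Real.pi / y), tr (y * u) * Real.exp (-k * u))‖
        ≤ ∫ u in Set.Ioc 0 (Real.pi / y), (1:ℝ) := by
      refine kc_integral Φ N R hΦ _ (fun u k => tr (y * u) * Real.exp (-k * u)) _ ?_ ?_ ?_
      · intro k
        have : Continuous (fun u => tr (y * u) * Real.exp (-k * u)) := by fun_prop
        exact (this.integrableOn_Icc).mono_set Set.Ioc_subset_Icc_self
      · simp
      · filter_upwards [MeasureTheory.ae_restrict_mem measurableSet_Ioc] with u hu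
        have e : (fun k : ℕ => tr (y * u) * Real.exp (-k * u)) =
          tr (y * u) • (fun k : ℕ => Real.exp (-k * u)) := by ext k; simp
        rw [e, map_smul, norm_smul]
        exact mul_le_one₀ (hb _) (norm_nonneg _) (kc_exp_norm Φ h1 u hu.1.le)
    simp only [← intervalIntegral.integral_of_le hpy.le] at hI
    simp only [hinteg] at hI
    rw [intervalIntegral.integral_const, sub_zero, smul_eq_mul, mul_one] at hI
    have e : c = (fun k : ℕ => c k * (1 + Real.exp (-k * (Real.pi / y)))) *
        (fun k => (1 + Real.exp (-(Real.pi / y)) ^ k)⁻¹) := by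
      ext k
      have : Real.exp (-(Real.pi / y)) ^ k = Real.exp (-k * (Real.pi / y)) := by
        rw [← Real.exp_nat_mul]; congr 1; ring
      simp only [Pi.mul_apply, this]
      have : 1 + Real.exp (-k * (Real.pi / y)) ≠ 0 := by positivity
      field_simp
    rw [e, map_mul]
    refine (norm_mul_le _ _).trans ?_
    refine (mul_le_mul hI hinv (norm_nonneg _) hpy.le).trans (le_of_eq (by ring))
  refine ⟨key Real.sin _ Real.continuous_sin Real.abs_sin_le_one fun k => kc_scal_sin k y hy,
    key Real.cos _ Real.continuous_cos Real.abs_cos_le_one fun k => kc_scal_cos k y hy⟩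

lemma kc_cubic (Φ : (ℕ → ℝ) →ₐ[ℝ] 𝒜) (y D : ℝ) (hD : 0 ≤ D) (hy : 0 < y) (hone : ‖(1:𝒜)‖ ≤ 1)
    (ha : ‖Φ (fun k => y / ((k:ℝ) ^ 2 + y ^ 2))‖ ≤ D / y)
    (hb : ‖Φ (fun k => k / ((k:ℝ) ^ 2 + y ^ 2))‖ ≤ D / y) :
    ‖Φ (fun k => (k:ℝ) ^ 2 * (k ^ 2 - 3 * y ^ 2) / ((k:ℝ) ^ 2 + y ^ 2) ^ 3)‖
      ≤ D ^ 2 * (1 + 4 * D) / y ^ 2 := by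
  set c : ℕ → ℝ := fun k => y / ((k:ℝ) ^ 2 + y ^ 2) with hc
  set a : ℕ → ℝ := fun k => k / ((k:ℝ) ^ 2 + y ^ 2) with haa
  have e : (fun k : ℕ => (k:ℝ) ^ 2 * (k ^ 2 - 3 * y ^ 2) / ((k:ℝ) ^ 2 + y ^ 2) ^ 3) =
      a * a * (1 - (4 * y) • c) := by
    ext k
    have : (k:ℝ) ^ 2 + y ^ 2 ≠ 0 := by positivity
    simp only [hc, haa, Pi.mul_apply, Pi.sub_apply, Pi.one_apply, Pi.smul_apply, smul_eq_mul]
    field_simp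
    ring
  rw [e, map_mul, map_mul, map_sub, map_one, map_smul]
  have h3 : ‖(1:𝒜) - (4 * y) • Φ c‖ ≤ 1 + 4 * D := by
    refine (norm_sub_le _ _).trans (add_le_add hone ?_)
    rw [norm_smul, Real.norm_of_nonneg (by positivity)]
    calc 4 * y * ‖Φ c‖ ≤ 4 * y * (D / y) := by gcongr
      _ = 4 * D := by field_simp
  calc _ ≤ ‖Φ a‖ * ‖Φ a‖ * ‖(1:𝒜) - (4 * y) • Φ c‖ := norm_mul₃_le
    _ ≤ D / y * (D / y) * (1 + 4 * D) := by gcongr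
    _ = _ := by field_simp

end AbstractK

section FourierScalar
open MeasureTheory Filter Topology FourierTransform

lemma fs_tend (k : ℝ) (hk : 0 < k) (n : ℕ) :
    Tendsto (fun u : ℝ => u ^ n * Real.exp (-k * u)) atTop (𝓝 0) := by
  have h := (Real.tendsto_pow_mul_exp_neg_atTop_nhds_zero n).comp
    (tendsto_id.const_mul_atTop hk)
  have h2 := h.const_mul ((k ^ n)⁻¹)
  rw [mul_zero] at h2
  refine h2.congr fun u => ?_
  simp only [Function.comp, id]
  rw [mul_pow, neg_mul]
  field_simp

lemma fs_int (k : ℝ) (hk : 0 < k) :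
    IntegrableOn (fun u : ℝ => u ^ 2 * Real.exp (-k * u)) (Set.Ioi 0) := by
  have := integrableOn_rpow_mul_exp_neg_mul_rpow (p := 1) (s := 2) (b := k) (by norm_num)
    (by norm_num) hk
  simpa using this

lemma fs_laplace (c : ℂ) (hc : 0 < c.re) :
    ∫ u in Set.Ioi (0:ℝ), (u:ℂ) ^ 2 * Complex.exp (-c * u) = 2 / c ^ 3 := by
  have hc0 : c ≠ 0 := by rintro rfl; simp at hc
  have hnorm : ∀ u : ℝ, ‖Complex.exp (-c * u)‖ = Real.exp (-c.re * u) := by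
    intro u; rw [Complex.norm_exp]; simp
  have hd : ∀ u : ℝ, HasDerivAt
      (fun u : ℝ => -((u:ℂ) ^ 2 / c + 2 * u / c ^ 2 + 2 / c ^ 3) * Complex.exp (-c * u))
      ((u:ℂ) ^ 2 * Complex.exp (-c * u)) u := by
    intro u
    have h0 : HasDerivAt (fun u : ℝ => (u:ℂ)) 1 u := Complex.ofRealCLM.hasDerivAt
    have h1 := (h0.const_mul (-c)).cexp
    have h2 := ((((h0.pow 2).div_const c).add ((h0.const_mul 2).div_const (c ^ 2))).add_const
      (2 / c ^ 3)).neg.mul h1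
    convert! h2 using 1
    simp
    field_simp
    ring
  have hinteg : IntegrableOn (fun u : ℝ => (u:ℂ) ^ 2 * Complex.exp (-c * u)) (Set.Ioi 0) := by
    refine Integrable.mono' (fs_int c.re hc) ?_ ?_
    · exact (by fun_prop : Continuous fun u : ℝ => (u:ℂ) ^ 2 * Complex.exp (-c * u)).aestronglyMeasurable
    · refine Eventually.of_forall fun u => ?_
      rw [norm_mul, hnorm]; simp
  have htend : Tendsto (fun u : ℝ => -((u:ℂ) ^ 2 / c + 2 * u / c ^ 2 + 2 / c ^ 3) *
      Complex.exp (-c * u)) atTop (𝓝 0) := by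
    have ht : ∀ n : ℕ, Tendsto (fun u : ℝ => (u:ℂ) ^ n * Complex.exp (-c * u)) atTop (𝓝 0) := by
      intro n
      rw [tendsto_zero_iff_norm_tendsto_zero]
      refine (fs_tend c.re hc n).abs.congr' ?_ |>.trans (by simp)
      filter_upwards with u
      rw [norm_mul, hnorm, abs_mul, Real.abs_exp]; simp
    have := (((ht 2).const_mul (-1 / c)).add ((ht 1).const_mul (-2 / c ^ 2))).add
      ((ht 0).const_mul (-2 / c ^ 3))
    simp only [mul_zero, add_zero] at this
    refine this.congr fun u => ?_
    ring
  rw [integral_Ioi_of_hasDerivAt_of_tendsto' (fun u _ => hd u) hinteg htend]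
  simp

lemma fs_norm_sq (k ξ : ℝ) : (k ^ 2 + (2 * Real.pi * ξ) ^ 2) =
    ‖(k : ℂ) + 2 * Real.pi * ξ * Complex.I‖ ^ 2 := by
  rw [← Complex.normSq_eq_norm_sq, Complex.normSq_apply]; simp; ring

lemma fs_hat_integrable (k : ℝ) (hk : 0 < k) :
    Integrable (fun ξ : ℝ => 2 / ((k : ℂ) + 2 * Real.pi * ξ * Complex.I) ^ 3) := by
  have h1 : Integrable (fun ξ : ℝ => 2 / k ^ 3 * (1 + (2 * Real.pi / k * ξ) ^ 2)⁻¹) :=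
    (integrable_inv_one_add_sq.comp_mul_left' (by positivity)).const_mul _
  have hne : ∀ ξ : ℝ, ((k : ℂ) + 2 * Real.pi * ξ * Complex.I) ≠ 0 := by
    intro ξ h
    have := congrArg Complex.re h
    simp at this; exact hk.ne' this
  refine h1.mono' ?_ ?_
  · refine Continuous.aestronglyMeasurable ?_
    refine Continuous.div (by fun_prop) (by fun_prop) fun ξ => pow_ne_zero _ (hne ξ)
  · refine Eventually.of_forall fun ξ => ?_
    rw [norm_div, norm_pow]
    set z := ‖(k : ℂ) + 2 * Real.pi * ξ * Complex.I‖ with hz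
    have hzs : k ^ 2 + (2 * Real.pi * ξ) ^ 2 = z ^ 2 := fs_norm_sq k ξ
    have hz0 : 0 ≤ z := norm_nonneg _
    have hkz : k ≤ z := by
      refine le_of_sq_le_sq ?_ hz0
      nlinarith [sq_nonneg (2 * Real.pi * ξ)]
    have e : 2 / k ^ 3 * (1 + (2 * Real.pi / k * ξ) ^ 2)⁻¹ = 2 / (k * z ^ 2) := by
      rw [← hzs]; field_simp
    rw [e]
    simp only [Complex.norm_ofNat]
    have hz1 : 0 < z := lt_of_lt_of_le hk hkz
    refine div_le_div_of_nonneg_left (by norm_num) (by positivity) ?_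
    nlinarith [sq_nonneg z]

lemma fs_inversion (k : ℝ) (hk : 0 < k) (v : ℝ) :
    ∫ ξ : ℝ, Complex.exp (((2 * Real.pi * (ξ * v) : ℝ) : ℂ) * Complex.I) *
      (2 / ((k : ℂ) + 2 * Real.pi * ξ * Complex.I) ^ 3) =
      (((max v 0) ^ 2 * Real.exp (-k * v) : ℝ) : ℂ) := by
  set f : ℝ → ℂ := fun u => (((max u 0) ^ 2 * Real.exp (-k * u) : ℝ) : ℂ) with hf
  have hfi : f = Set.indicator (Set.Ioi 0) (fun u : ℝ => ((u ^ 2 * Real.exp (-k * u) : ℝ) : ℂ)) := by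
    ext u
    by_cases hu : 0 < u
    · simp [hf, Set.indicator, hu, max_eq_left hu.le]
    · simp [hf, Set.indicator, hu, max_eq_right (not_lt.1 hu)]
  have hcont : Continuous f := by
    rw [hf]; fun_prop
  have hinteg : Integrable f := by
    rw [hfi, integrable_indicator_iff measurableSet_Ioi]
    exact (fs_int k hk).ofReal
  have hhat : 𝓕 f = fun ξ : ℝ => 2 / ((k : ℂ) + 2 * Real.pi * ξ * Complex.I) ^ 3 := by
    ext ξ
    rw [Real.fourier_real_eq_integral_exp_smul, ← fs_laplace _ (by simpa using hk),
      ← integral_indicator measurableSet_Ioi]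
    congr 1
    ext u
    rw [hfi]
    by_cases hu : 0 < u
    · simp only [Set.indicator, Set.mem_Ioi, hu, if_true, smul_eq_mul]
      push_cast
      rw [mul_left_comm, ← Complex.exp_add]
      congr 2
      ring
    · simp [Set.indicator, hu]
  have := congrFun (hcont.fourierInv_fourier_eq hinteg
    (by rw [hhat]; exact fs_hat_integrable k hk)) v
  rw [hhat, Real.fourierInv_eq'] at this
  simp only [smul_eq_mul] at this
  refine Eq.trans ?_ this
  congr 1
  ext ξ
  simp [mul_comm]

lemma fs_cubic_integrable (k : ℝ) (hk : 0 < k) (t : ℝ) :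
    Integrable (fun ξ : ℝ => (2 * Real.cos (2 * Real.pi * ξ * t) - 2) *
      (2 * (k ^ 2 * (k ^ 2 - 3 * (2 * Real.pi * ξ) ^ 2) / (k ^ 2 + (2 * Real.pi * ξ) ^ 2) ^ 3))) ∧
    ∫ ξ : ℝ, (2 * Real.cos (2 * Real.pi * ξ * t) - 2) *
      (2 * (k ^ 2 * (k ^ 2 - 3 * (2 * Real.pi * ξ) ^ 2) / (k ^ 2 + (2 * Real.pi * ξ) ^ 2) ^ 3)) =
      k * ((max t 0) ^ 2 * Real.exp (-k * t) + (max (-t) 0) ^ 2 * Real.exp (-k * (-t))) := by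
  have hE : ∀ v : ℝ, Integrable (fun ξ : ℝ =>
      Complex.exp (((2 * Real.pi * (ξ * v) : ℝ) : ℂ) * Complex.I) *
      (2 / ((k : ℂ) + 2 * Real.pi * ξ * Complex.I) ^ 3)) := by
    intro v
    refine (fs_hat_integrable k hk).bdd_mul (c := 1) ?_ ?_
    · exact (by fun_prop : Continuous fun ξ : ℝ =>
        Complex.exp (((2 * Real.pi * (ξ * v) : ℝ) : ℂ) * Complex.I)).aestronglyMeasurable
    · exact Eventually.of_forall fun ξ => by rw [Complex.norm_exp_ofReal_mul_I]
  have hI := ((hE t).add (hE (-t))).sub ((hE 0).const_mul 2)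
  have hv : ∫ ξ : ℝ, ((Complex.exp (((2 * Real.pi * (ξ * t) : ℝ) : ℂ) * Complex.I) *
      (2 / ((k : ℂ) + 2 * Real.pi * ξ * Complex.I) ^ 3) +
      Complex.exp (((2 * Real.pi * (ξ * (-t)) : ℝ) : ℂ) * Complex.I) *
      (2 / ((k : ℂ) + 2 * Real.pi * ξ * Complex.I) ^ 3)) - 2 *
      (Complex.exp (((2 * Real.pi * (ξ * 0) : ℝ) : ℂ) * Complex.I) *
      (2 / ((k : ℂ) + 2 * Real.pi * ξ * Complex.I) ^ 3))) =
      (((max t 0) ^ 2 * Real.exp (-k * t) : ℝ) : ℂ) +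
      (((max (-t) 0) ^ 2 * Real.exp (-k * (-t)) : ℝ) : ℂ) := by
    have h1 := integral_sub ((hE t).add (hE (-t))) ((hE 0).const_mul 2)
    have h2 := integral_add (hE t) (hE (-t))
    simp only [Pi.add_apply] at h1
    rw [h1, h2, integral_const_mul, fs_inversion k hk, fs_inversion k hk, fs_inversion k hk]
    simp
  have hpt : ∀ ξ : ℝ, (2 * Real.cos (2 * Real.pi * ξ * t) - 2) *
      (2 * (k ^ 2 * (k ^ 2 - 3 * (2 * Real.pi * ξ) ^ 2) / (k ^ 2 + (2 * Real.pi * ξ) ^ 2) ^ 3)) =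
      k * (((Complex.exp (((2 * Real.pi * (ξ * t) : ℝ) : ℂ) * Complex.I) *
      (2 / ((k : ℂ) + 2 * Real.pi * ξ * Complex.I) ^ 3) +
      Complex.exp (((2 * Real.pi * (ξ * (-t)) : ℝ) : ℂ) * Complex.I) *
      (2 / ((k : ℂ) + 2 * Real.pi * ξ * Complex.I) ^ 3)) - 2 *
      (Complex.exp (((2 * Real.pi * (ξ * 0) : ℝ) : ℂ) * Complex.I) *
      (2 / ((k : ℂ) + 2 * Real.pi * ξ * Complex.I) ^ 3)))).re := by
    intro ξ
    set y := 2 * Real.pi * ξ with hy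
    have e1 : ((2 * Real.pi * (ξ * t) : ℝ) : ℂ) = ((y * t : ℝ) : ℂ) := by rw [hy]; push_cast; ring
    have e2 : ((2 * Real.pi * (ξ * (-t)) : ℝ) : ℂ) = ((-(y * t) : ℝ) : ℂ) := by
      rw [hy]; push_cast; ring
    have e3 : (2 * Real.pi * ξ * Complex.I : ℂ) = (y : ℂ) * Complex.I := by
      rw [hy]; push_cast; ring
    rw [e1, e2, e3]
    have hne : (k : ℂ) + y * Complex.I ≠ 0 := by
      intro h
      have := congrArg Complex.re h
      simp at this; exact hk.ne' this
    have hne2 : k ^ 2 + y ^ 2 ≠ 0 := by positivity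
    have e4 : (2 / ((k : ℂ) + y * Complex.I) ^ 3) =
      ((2 * (k ^ 3 - 3 * k * y ^ 2) / (k ^ 2 + y ^ 2) ^ 3 : ℝ) : ℂ) +
        ((2 * (y ^ 3 - 3 * k ^ 2 * y) / (k ^ 2 + y ^ 2) ^ 3 : ℝ) : ℂ) * Complex.I := by
      have hne3 : ((k:ℂ) ^ 2 + (y:ℂ) ^ 2) ≠ 0 := by exact_mod_cast hne2
      rw [div_eq_iff (pow_ne_zero _ hne)]
      push_cast
      field_simp
      ring_nf
      have hI2 : Complex.I ^ 2 = -1 := Complex.I_sq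
      have hI3 : Complex.I ^ 3 = -Complex.I := by rw [pow_succ, hI2]; ring
      have hI4 : Complex.I ^ 4 = 1 := by rw [Complex.I_pow_four]
      simp only [hI2, hI3, hI4]
      ring
    rw [e4]
    have e5 : ∀ x : ℝ, Complex.exp ((x:ℂ) * Complex.I) =
        (Real.cos x : ℂ) + (Real.sin x : ℂ) * Complex.I := by
      intro x; rw [Complex.exp_mul_I]; push_cast; rfl
    rw [e5, e5, e5]
    have e8 : (2 * Real.cos (y * t) - 2) *
        (2 * (k ^ 2 * (k ^ 2 - 3 * y ^ 2) / (k ^ 2 + y ^ 2) ^ 3)) = k * ((2 * Real.cos (y * t) - 2) *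
          (2 * (k ^ 3 - 3 * k * y ^ 2) / (k ^ 2 + y ^ 2) ^ 3)) := by ring
    rw [e8]
    generalize 2 * (k ^ 3 - 3 * k * y ^ 2) / (k ^ 2 + y ^ 2) ^ 3 = a
    generalize 2 * (y ^ 3 - 3 * k ^ 2 * y) / (k ^ 2 + y ^ 2) ^ 3 = b
    simp [-Complex.ofReal_cos, -Complex.ofReal_sin]
    left
    ring
  constructor
  · simp only [hpt]
    exact (hI.re).const_mul k
  · simp only [hpt]
    rw [integral_const_mul]
    have := integral_re hI
    simp only [Pi.add_apply, Pi.sub_apply] at this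
    have h3 : ∀ z : ℂ, RCLike.re z = z.re := fun z => rfl
    simp only [h3] at this
    rw [this, hv]
    rw [← Complex.ofReal_add, Complex.ofReal_re]

end FourierScalar

section AbstractK2

variable {𝒜 : Type*} [NormedRing 𝒜] [NormedAlgebra ℝ 𝒜] [CompleteSpace 𝒜]

lemma kc_cos_bound (x : ℝ) : |2 * Real.cos x - 2| ≤ 5 * x ^ 2 / (1 + x ^ 2) := by
  have h1 := Real.one_sub_sq_div_two_le_cos (x := x)
  have h2 := Real.cos_le_one x
  have h3 := Real.neg_one_le_cos x
  rw [abs_of_nonpos (by linarith), le_div_iff₀ (by positivity)]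
  nlinarith [sq_nonneg x]

open MeasureTheory in
lemma kc_deriv (Φ : (ℕ → ℝ) →ₐ[ℝ] 𝒜) (N : ℕ) (R : ℕ → 𝒜)
    (hΦ : ∀ m, Φ m = ∑ k ∈ range N, m k • R k) (C : ℝ) (hC : 0 ≤ C)
    (h : ∀ y : ℝ, 0 < y → ‖Φ (fun k => (k:ℝ) ^ 2 * (k ^ 2 - 3 * y ^ 2) / ((k:ℝ) ^ 2 + y ^ 2) ^ 3)‖
      ≤ C / y ^ 2) (t : ℝ) (ht : 0 < t) :
    ‖Φ (fun k => k * Real.exp (-k * t))‖ ≤ 5 * C / t := by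
  have hpi := Real.pi_pos
  have key := kc_integral Φ N R hΦ (volume : Measure ℝ)
    (fun ξ k => (2 * Real.cos (2 * Real.pi * ξ * t) - 2) *
      (2 * ((k:ℝ) ^ 2 * (k ^ 2 - 3 * (2 * Real.pi * ξ) ^ 2) / (k ^ 2 + (2 * Real.pi * ξ) ^ 2) ^ 3)))
    (fun ξ => (10 * C * t ^ 2) * (1 + (2 * Real.pi * t * ξ) ^ 2)⁻¹) ?_ ?_ ?_
  · rw [integral_const_mul] at key
    have e1 := Measure.integral_comp_mul_left (fun x : ℝ => (1 + x ^ 2)⁻¹) (2 * Real.pi * t)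
    rw [e1, integral_univ_inv_one_add_sq, abs_of_pos (by positivity), smul_eq_mul] at key
    have e2 : (fun k : ℕ => ∫ ξ : ℝ, (2 * Real.cos (2 * Real.pi * ξ * t) - 2) *
      (2 * ((k:ℝ) ^ 2 * (k ^ 2 - 3 * (2 * Real.pi * ξ) ^ 2) / (k ^ 2 + (2 * Real.pi * ξ) ^ 2) ^ 3)))
      = (t ^ 2) • (fun k : ℕ => k * Real.exp (-k * t)) := by
      ext k
      rcases Nat.eq_zero_or_pos k with rfl | hk
      · simp
      · rw [(fs_cubic_integrable k (by exact_mod_cast hk) t).2]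
        rw [max_eq_left ht.le, max_eq_right (by linarith)]
        simp; ring
    rw [e2, map_smul, norm_smul, Real.norm_of_nonneg (by positivity)] at key
    rw [le_div_iff₀ ht]
    have : t * (‖Φ (fun k => k * Real.exp (-k * t))‖ * t) ≤ t * (5 * C) := by
      calc _ = t ^ 2 * ‖Φ (fun k => k * Real.exp (-k * t))‖ := by ring
        _ ≤ _ := key
        _ = t * (5 * C) := by field_simp; ring
    exact le_of_mul_le_mul_left this ht
  · intro k
    rcases Nat.eq_zero_or_pos k with rfl | hk
    · simp
    · exact (fs_cubic_integrable k (by exact_mod_cast hk) t).1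
  · exact ((integrable_inv_one_add_sq).comp_mul_left' (by positivity)).const_mul _
  · have : ∀ᵐ ξ : ℝ, ξ ≠ 0 := by simp [ae_iff]
    filter_upwards [this] with ξ hξ
    have hy : 0 < |2 * Real.pi * ξ| := abs_pos.2 (by positivity)
    have hb := h _ hy
    simp only [sq_abs] at hb
    set m : ℕ → ℝ := fun k => (k:ℝ) ^ 2 * (k ^ 2 - 3 * (2 * Real.pi * ξ) ^ 2) / (k ^ 2 + (2 * Real.pi * ξ) ^ 2) ^ 3
    have e : (fun k : ℕ => (2 * Real.cos (2 * Real.pi * ξ * t) - 2) * (2 * m k)) =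
      ((2 * Real.cos (2 * Real.pi * ξ * t) - 2) * 2) • m := by ext k; simp; ring
    change ‖Φ (fun k : ℕ => (2 * Real.cos (2 * Real.pi * ξ * t) - 2) * (2 * m k))‖ ≤ _
    rw [e, map_smul, norm_smul, Real.norm_eq_abs, abs_mul]
    have hc := kc_cos_bound (2 * Real.pi * ξ * t)
    calc _ ≤ (5 * (2 * Real.pi * ξ * t) ^ 2 / (1 + (2 * Real.pi * ξ * t) ^ 2) * |2|) *
          (C / (2 * Real.pi * ξ) ^ 2) := by gcongr
      _ = _ := by
        rw [abs_of_pos (by norm_num : (0:ℝ) < 2)]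
        have : 2 * Real.pi * t * ξ = 2 * Real.pi * ξ * t := by ring
        rw [this]
        have : 1 + (2 * Real.pi * ξ * t) ^ 2 ≠ 0 := by positivity
        field_simp
        ring

lemma kc_pow (Φ : (ℕ → ℝ) →ₐ[ℝ] 𝒜) (B : ℝ) (hB : 0 ≤ B)
    (h : ∀ t : ℝ, 0 < t → ‖Φ (fun k => k * Real.exp (-k * t))‖ ≤ B / t) (t : ℝ) (ht : 0 < t)
    (m : ℕ) (hm : 0 < m) :
    ‖Φ (fun k => (k:ℝ) ^ m * Real.exp (-k * t))‖ ≤ (B * m / t) ^ m := by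
  have e : (fun k : ℕ => (k:ℝ) ^ m * Real.exp (-k * t)) =
      (fun k : ℕ => k * Real.exp (-k * (t / m))) ^ m := by
    ext k
    simp only [Pi.pow_apply, mul_pow, ← Real.exp_nat_mul]
    congr 2
    field_simp
  rw [e, map_pow]
  have hm' : (0:ℝ) < m := by exact_mod_cast hm
  refine (norm_pow_le' _ hm).trans ?_
  refine (pow_le_pow_left₀ (norm_nonneg _) (h (t / m) (by positivity)) m).trans (le_of_eq ?_)
  congr 1
  field_simp

open MeasureTheory in
lemma kc_sin (Φ : (ℕ → ℝ) →ₐ[ℝ] 𝒜) (N : ℕ) (R : ℕ → 𝒜)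
    (hΦ : ∀ m, Φ m = ∑ k ∈ range N, m k • R k) (B : ℝ) (hB : 0 < B)
    (h : ∀ t : ℝ, 0 < t → ‖Φ (fun k => k * Real.exp (-k * t))‖ ≤ B / t)
    (s : ℝ) (hs : 0 ≤ s) (hs' : s ≤ Real.pi) :
    ‖Φ (fun k => Real.sin (s * k) * Real.exp (-k * (2 * Real.pi * Real.exp 1 * B)))‖ ≤ 2 := by
  have hpi := Real.pi_pos
  set t := 2 * Real.pi * Real.exp 1 * B with htdef
  have ht : 0 < t := by positivity
  have hg : HasSum (fun j : ℕ => ((1:ℝ) / 2) ^ j) 2 := hasSum_geometric_two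
  refine kc_tsum Φ N R hΦ
    (fun j k => ((-1) ^ j * (s * k) ^ (2 * j + 1) / (Nat.factorial (2 * j + 1))) * Real.exp (-k * t))
      _ _ _ ?_ hg ?_
  · intro k
    exact (Real.hasSum_sin (s * k)).mul_right _
  · intro j
    set m := 2 * j + 1 with hm
    have e : (fun k : ℕ => ((-1) ^ j * (s * k) ^ m / (Nat.factorial m : ℝ)) * Real.exp (-k * t)) =
      ((-1) ^ j * s ^ m / (Nat.factorial m : ℝ)) • (fun k : ℕ => (k:ℝ) ^ m * Real.exp (-k * t)) := by
      ext k; simp only [Pi.smul_apply, smul_eq_mul]; ring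
    rw [e, map_smul, norm_smul]
    have h1 := kc_pow Φ B hB.le h t ht m (by omega)
    have h2 : ‖((-1) ^ j * s ^ m / (Nat.factorial m : ℝ) : ℝ)‖ = s ^ m / (Nat.factorial m : ℝ) := by
      rw [norm_div, norm_mul, norm_pow, norm_neg, norm_one, one_pow, one_mul,
        Real.norm_of_nonneg (by positivity), Real.norm_of_nonneg (by positivity)]
    rw [h2]
    have h3 := Real.pow_div_factorial_le_exp (m:ℝ) (by positivity) m
    calc s ^ m / (Nat.factorial m : ℝ) * ‖Φ (fun k => (k:ℝ) ^ m * Real.exp (-k * t))‖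
        ≤ Real.pi ^ m / (Nat.factorial m : ℝ) * (B * m / t) ^ m := by gcongr
      _ = (Real.pi * B / t) ^ m * ((m:ℝ) ^ m / (Nat.factorial m : ℝ)) := by
        rw [div_pow, div_pow, mul_pow, mul_pow]; ring
      _ ≤ (Real.pi * B / t) ^ m * Real.exp m := by gcongr
      _ = ((1:ℝ) / 2) ^ m := by
        rw [← Real.exp_one_pow, ← mul_pow]
        congr 1
        rw [htdef]; field_simp
      _ ≤ ((1:ℝ) / 2) ^ j := pow_le_pow_of_le_one (by norm_num) (by norm_num) (by omega)

lemma kc_orth (k : ℕ) : ∫ s in (0:ℝ)..Real.pi, Real.sin s * Real.sin (s * k) =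
    if k = 1 then Real.pi / 2 else 0 := by
  split_ifs with hk
  · subst hk
    have := integral_sin_sq (a := 0) (b := Real.pi)
    simp only [Nat.cast_one, mul_one]
    simp only [sq] at this
    rw [this]; simp
  · have hk1 : (k:ℝ) - 1 ≠ 0 := by
      intro h; apply hk; have : (k:ℝ) = 1 := by linarith
      exact_mod_cast this
    have hk2 : (k:ℝ) + 1 ≠ 0 := by positivity
    have hd : ∀ x ∈ Set.uIcc (0:ℝ) Real.pi, HasDerivAt (fun x : ℝ =>
        (Real.sin (((k:ℝ) - 1) * x) / (k - 1) - Real.sin (((k:ℝ) + 1) * x) / (k + 1)) / 2)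
        (Real.sin x * Real.sin (x * k)) x := by
      intro x _
      have a1 : HasDerivAt (fun x : ℝ => Real.sin (((k:ℝ) - 1) * x))
          (Real.cos (((k:ℝ) - 1) * x) * ((k:ℝ) - 1)) x := by
        have := (hasDerivAt_id x).const_mul ((k:ℝ) - 1)
        simpa using this.sin
      have a2 : HasDerivAt (fun x : ℝ => Real.sin (((k:ℝ) + 1) * x))
          (Real.cos (((k:ℝ) + 1) * x) * ((k:ℝ) + 1)) x := by
        have := (hasDerivAt_id x).const_mul ((k:ℝ) + 1)
        simpa using this.sin
      refine (((a1.div_const ((k:ℝ) - 1)).sub (a2.div_const ((k:ℝ) + 1))).div_const 2).congr_deriv ?_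
      rw [mul_div_cancel_right₀ _ hk1, mul_div_cancel_right₀ _ hk2]
      rw [sub_mul, add_mul, one_mul, Real.cos_sub, Real.cos_add, mul_comm (k:ℝ) x]
      ring
    rw [intervalIntegral.integral_eq_sub_of_hasDerivAt hd
      ((by fun_prop : Continuous fun s : ℝ => Real.sin s * Real.sin (s * k)).intervalIntegrable _ _)]
    have b1 : Real.sin (((k:ℝ) - 1) * Real.pi) = 0 := by
      have := Real.sin_int_mul_pi ((k:ℤ) - 1)
      push_cast at this; exact this
    have b2 : Real.sin (((k:ℝ) + 1) * Real.pi) = 0 := by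
      have := Real.sin_int_mul_pi ((k:ℤ) + 1)
      push_cast at this; exact this
    simp [b1, b2]

open MeasureTheory in
lemma kc_proj (Φ : (ℕ → ℝ) →ₐ[ℝ] 𝒜) (N : ℕ) (R : ℕ → 𝒜)
    (hΦ : ∀ m, Φ m = ∑ k ∈ range N, m k • R k) (t : ℝ)
    (h : ∀ s : ℝ, 0 ≤ s → s ≤ Real.pi →
      ‖Φ (fun k => Real.sin (s * k) * Real.exp (-k * t))‖ ≤ 2) :
    ‖Φ (fun k => if k = 1 then 1 else 0)‖ ≤ 4 * Real.exp t := by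
  have hpi := Real.pi_pos
  have key := kc_integral Φ N R hΦ (volume.restrict (Set.Ioc 0 Real.pi))
    (fun s k => Real.sin s * (Real.sin (s * k) * Real.exp (-k * t))) (fun _ => 2) ?_ ?_ ?_
  · simp only [← intervalIntegral.integral_of_le hpi.le, ← mul_assoc,
      intervalIntegral.integral_mul_const, kc_orth] at key
    rw [intervalIntegral.integral_const, sub_zero, smul_eq_mul] at key
    have e : (fun k : ℕ => (if k = 1 then (1:ℝ) else 0)) = (2 / Real.pi * Real.exp t) •
      (fun k : ℕ => (if k = 1 then Real.pi / 2 else 0) * Real.exp (-k * t)) := by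
      ext k
      simp only [Pi.smul_apply, smul_eq_mul]
      split_ifs with hk
      · subst hk
        have : Real.exp t * Real.exp (-((1:ℕ):ℝ) * t) = 1 := by
          rw [← Real.exp_add]; simp
        calc (1:ℝ) = (2 / Real.pi) * (Real.pi / 2) * (Real.exp t * Real.exp (-((1:ℕ):ℝ) * t)) := by
              rw [this]; field_simp
          _ = _ := by ring
      · simp
    rw [e, map_smul, norm_smul, Real.norm_of_nonneg (by positivity)]
    calc _ ≤ 2 / Real.pi * Real.exp t * (Real.pi * 2) := by gcongr
      _ = _ := by field_simp; ring
  · intro k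
    have : Continuous (fun s : ℝ => Real.sin s * (Real.sin (s * k) * Real.exp (-k * t))) := by fun_prop
    exact (this.integrableOn_Icc).mono_set Set.Ioc_subset_Icc_self
  · simp
  · filter_upwards [MeasureTheory.ae_restrict_mem measurableSet_Ioc] with s hs
    have e : (fun k : ℕ => Real.sin s * (Real.sin (s * k) * Real.exp (-k * t))) =
      Real.sin s • (fun k : ℕ => (Real.sin (s * k) * Real.exp (-k * t))) := by
        ext k; simp
    rw [e, map_smul, norm_smul]
    have := h s hs.1.le hs.2
    have h4 := Real.abs_sin_le_one s
    calc _ ≤ 1 * (2:ℝ) := by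
          gcongr; exact h4
      _ = 2 := by ring

/-- The abstract K-convexity lemma. -/
lemma kc_main (M : ℕ) (hM : 0 < M) : ∃ K : ℝ, 0 < K ∧
    ∀ (𝒜 : Type*) [NormedRing 𝒜] [NormedAlgebra ℝ 𝒜] [CompleteSpace 𝒜]
    (Φ : (ℕ → ℝ) →ₐ[ℝ] 𝒜) (N : ℕ) (R : ℕ → 𝒜),
    (∀ m, Φ m = ∑ k ∈ range N, m k • R k) →
    (∀ ρ : ℝ, 0 ≤ ρ → ρ ≤ 1 → ‖Φ (fun k => ρ ^ k)‖ ≤ 1) →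
    (∀ ρ : ℝ, 0 ≤ ρ → ρ ≤ 1 → ‖Φ (fun k => (1 - ρ ^ k) ^ M)‖ ≤ 3 / 4 * 2 ^ M) →
    ‖Φ (fun k => if k = 1 then 1 else 0)‖ ≤ K := by
  have hpi := Real.pi_pos
  have hM' : (0:ℝ) < M := by exact_mod_cast hM
  set D : ℝ := 2 * M * Real.pi with hD
  have hD0 : 0 < D := by positivity
  refine ⟨4 * Real.exp (2 * Real.pi * Real.exp 1 * (5 * (D ^ 2 * (1 + 4 * D)))), by positivity, ?_⟩
  intro 𝒜 _ _ _ Φ N R hΦ h1 h2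
  refine kc_proj Φ N R hΦ _ ?_
  refine kc_sin Φ N R hΦ _ (by positivity) ?_
  refine kc_deriv Φ N R hΦ _ (by positivity) ?_
  intro y hy
  have hr := kc_resolvent Φ N R hΦ M h1 h2 y hy
  refine kc_cubic Φ y D hD0.le hy ?_ hr.1 hr.2
  have := h1 1 zero_le_one le_rfl
  simp only [one_pow] at this
  have e : (fun _ : ℕ => (1:ℝ)) = 1 := rfl
  rwa [e, map_one] at this

end AbstractK2

section StarSec

/-- Improved triangle inequality for `M` vectors. -/
def StarP (X : Type*) [NormedAddCommGroup X] [NormedSpace ℝ X] (M : ℕ) (p : ℝ) : Prop :=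
  ∀ x : Fin M → X, cubeAvg (fun θ : Fin M → Bool => ‖∑ i, rad (θ i) • x i‖ ^ p) ≤
    (1 / 2) ^ p * (M : ℝ) ^ (p - 1) * ∑ i, ‖x i‖ ^ p

lemma abs_rad (b : Bool) : |rad b| = 1 := by cases b <;> simp [rad]

lemma rad_mul_self (b : Bool) : rad b * rad b = 1 := by cases b <;> simp [rad]

lemma cubeAvg_mono {n : ℕ} {f g : (Fin n → Bool) → ℝ} (h : ∀ ε, f ε ≤ g ε) :
    cubeAvg f ≤ cubeAvg g := by
  unfold cubeAvg
  simp only [smul_eq_mul]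
  gcongr with ε
  exact h ε

lemma cubeAvg_nonneg {n : ℕ} {f : (Fin n → Bool) → ℝ} (h : ∀ ε, 0 ≤ f ε) :
    0 ≤ cubeAvg f := by
  unfold cubeAvg
  simp only [smul_eq_mul]
  have := Finset.sum_nonneg (s := univ) fun i _ => h i
  positivity

lemma cubeAvg_const_mul {n : ℕ} (c : ℝ) (f : (Fin n → Bool) → ℝ) :
    cubeAvg (fun ε => c * f ε) = c * cubeAvg f := by
  unfold cubeAvg
  simp only [smul_eq_mul, ← Finset.mul_sum]
  ring

lemma exists_nat_rpow_ge (c e : ℝ) (he : 0 < e) : ∃ M : ℕ, 1 ≤ M ∧ c ≤ (M : ℝ) ^ e := by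
  have h := (tendsto_rpow_atTop he).comp tendsto_natCast_atTop_atTop
  obtain ⟨M, h1, h2⟩ := ((Filter.eventually_ge_atTop 1).and
    (h.eventually (Filter.eventually_ge_atTop c))).exists
  exact ⟨M, h1, h2⟩

/-- Jensen for powers. -/
lemma cubeAvg_rpow_le {n : ℕ} (f : (Fin n → Bool) → ℝ) (hf : ∀ ε, 0 ≤ f ε) (q : ℝ) (hq : 1 ≤ q) :
    (cubeAvg f) ^ q ≤ cubeAvg (fun ε => f ε ^ q) := by
  have := Real.rpow_arith_mean_le_arith_mean_rpow univ (fun _ : Fin n → Bool => ((2:ℝ) ^ n)⁻¹) f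
    (fun _ _ => by positivity) (by simp) (fun i _ => hf i) hq
  unfold cubeAvg
  simpa [smul_eq_mul, Finset.mul_sum] using this

lemma Q_bound {M : ℕ} (a : Fin M → ℝ) (ha : ∀ i, 0 ≤ a i) (s p r : ℝ) (hr0 : 0 < r) (hrs : r ≤ s)
    (hrp : r ≤ p) :
    ((∑ i, a i ^ s) ^ (1 / s)) ^ p ≤ (M:ℝ) ^ (p / r - 1) * ∑ i, a i ^ p := by
  have hs0 : 0 < s := by linarith
  have hp0 : 0 < p := by linarith
  have hb : ∀ i, 0 ≤ a i ^ r := fun i => Real.rpow_nonneg (ha i) _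
  have hsum : 0 ≤ ∑ i, a i ^ r := Finset.sum_nonneg fun i _ => hb i
  have hsums : 0 ≤ ∑ i, a i ^ s := Finset.sum_nonneg fun i _ => Real.rpow_nonneg (ha i) _
  have h1 : (∑ i, a i ^ s) ≤ (∑ i, a i ^ r) ^ (s / r) := by
    -- each a_i^r ≤ total
    have key : ∀ i, a i ^ s ≤ a i ^ r * (∑ i, a i ^ r) ^ (s / r - 1) := by
      intro i
      have e : a i ^ s = (a i ^ r) ^ (s / r) := by
        rw [← Real.rpow_mul (ha i)]; congr 1; field_simp
      have h1sr : 1 ≤ s / r := (one_le_div hr0).2 hrs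
      have e2 : (a i ^ r) ^ (s / r) = a i ^ r * (a i ^ r) ^ (s / r - 1) := by
        rcases (hb i).eq_or_lt with h | h
        · rw [← h]; rw [Real.zero_rpow (by positivity)]; simp
        · rw [Real.rpow_sub_one h.ne']; field_simp
      rw [e, e2]
      refine mul_le_mul_of_nonneg_left ?_ (hb i)
      exact Real.rpow_le_rpow (hb i) (Finset.single_le_sum (fun i _ => hb i) (mem_univ i))
        (by linarith)
    refine (Finset.sum_le_sum fun i _ => key i).trans ?_
    rw [← Finset.sum_mul]
    rcases hsum.eq_or_lt with h | h
    · rw [← h]; rw [zero_mul]; positivity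
    · rw [Real.rpow_sub_one h.ne']; apply le_of_eq; field_simp
  have h2 := Real.rpow_sum_le_const_mul_sum_rpow (s := univ) (f := fun i => a i ^ r) (p := p / r)
    ((one_le_div hr0).2 hrp)
  simp only [Finset.card_univ, Fintype.card_fin, abs_of_nonneg (hb _)] at h2
  have e3 : ∀ i, (a i ^ r) ^ (p / r) = a i ^ p := fun i => by
    rw [← Real.rpow_mul (ha i)]; congr 1; field_simp
  simp only [e3] at h2
  refine le_trans ?_ h2
  rw [← Real.rpow_mul hsums]
  calc (∑ i, a i ^ s) ^ (1 / s * p) ≤ ((∑ i, a i ^ r) ^ (s / r)) ^ (1 / s * p) :=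
        Real.rpow_le_rpow hsums h1 (by positivity)
    _ = _ := by rw [← Real.rpow_mul hsum]; congr 1; field_simp

lemma star_of_type (s p T : ℝ) (hs1 : 1 < s) (hs2 : s ≤ 2) (hp1 : 1 < p) (hT : 0 < T) :
    ∃ M : ℕ, 1 ≤ M ∧ ∀ (X : Type*) [NormedAddCommGroup X] [NormedSpace ℝ X],
      HasTypeConst X s T → StarP X M p := by
  by_cases hp2 : p ≤ 2
  · set r := min s p with hr
    have hr1 : 1 < r := lt_min hs1 hp1
    obtain ⟨M, hM1, hM⟩ := exists_nat_rpow_ge (T ^ p * 2 ^ p) (p - p / r) (by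
      have : p / r < p := div_lt_self (by linarith) hr1
      linarith)
    refine ⟨M, hM1, fun X _ _ hX x => ?_⟩
    have hM0 : (0:ℝ) < M := by exact_mod_cast hM1
    have hQ := Q_bound (fun i => ‖x i‖) (fun i => norm_nonneg _) s p r (by linarith)
      (min_le_left _ _) (min_le_right _ _)
    have hty := hX M x
    set E2 := cubeAvg (fun δ : Fin M → Bool => ‖∑ j, rad (δ j) • x j‖ ^ (2 : ℝ)) with hE2
    have hE20 : 0 ≤ E2 := cubeAvg_nonneg fun ε => by positivity
    have hE : cubeAvg (fun θ : Fin M → Bool => ‖∑ i, rad (θ i) • x i‖ ^ p) ≤ (E2 ^ (1 / 2 : ℝ)) ^ p := by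
      have h0 : 0 ≤ cubeAvg (fun θ : Fin M → Bool => ‖∑ i, rad (θ i) • x i‖ ^ p) :=
        cubeAvg_nonneg fun ε => by positivity
      have := cubeAvg_rpow_le (fun θ : Fin M → Bool => ‖∑ i, rad (θ i) • x i‖ ^ p)
        (fun ε => by positivity) (2 / p) ((one_le_div (by linarith)).2 hp2)
      have e : ∀ θ : Fin M → Bool, (‖∑ i, rad (θ i) • x i‖ ^ p) ^ (2 / p) =
          ‖∑ i, rad (θ i) • x i‖ ^ (2:ℝ) := fun θ => by
        rw [← Real.rpow_mul (norm_nonneg _)]; congr 1; field_simp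
      simp only [e] at this
      have h3 := Real.rpow_le_rpow (by positivity) this (by positivity : 0 ≤ p / 2)
      rw [← Real.rpow_mul h0] at h3
      have e4 : 2 / p * (p / 2) = 1 := by field_simp
      rw [e4, Real.rpow_one] at h3
      refine h3.trans (le_of_eq ?_)
      rw [← Real.rpow_mul hE20]; congr 1; ring
    have hsum0 : 0 ≤ ∑ i, ‖x i‖ ^ p := Finset.sum_nonneg fun i _ => by positivity
    have hQ0 : 0 ≤ (∑ i, ‖x i‖ ^ s) ^ (1 / s) := by positivity
    calc _ ≤ (E2 ^ (1 / 2 : ℝ)) ^ p := hE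
      _ ≤ (T * (∑ j, ‖x j‖ ^ s) ^ (1 / s)) ^ p := by gcongr
      _ = T ^ p * ((∑ j, ‖x j‖ ^ s) ^ (1 / s)) ^ p := Real.mul_rpow hT.le hQ0
      _ ≤ T ^ p * ((M:ℝ) ^ (p / r - 1) * ∑ i, ‖x i‖ ^ p) := by gcongr
      _ = (1 / 2) ^ p * (T ^ p * 2 ^ p) * (M:ℝ) ^ (p / r - 1) * ∑ i, ‖x i‖ ^ p := by
        rw [Real.div_rpow (by norm_num) (by norm_num), Real.one_rpow]
        field_simp
      _ ≤ (1 / 2) ^ p * (M:ℝ) ^ (p - p / r) * (M:ℝ) ^ (p / r - 1) * ∑ i, ‖x i‖ ^ p := by gcongr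
      _ = _ := by
        rw [mul_assoc ((1 / 2 : ℝ) ^ p), ← Real.rpow_add hM0]
        congr 3; ring
  · push Not at hp2
    obtain ⟨M, hM1, hM⟩ := exists_nat_rpow_ge (T ^ (2:ℝ) * 2 ^ p) (2 - 2 / s) (by
      have : 2 / s < 2 := div_lt_self (by linarith) hs1
      linarith)
    refine ⟨M, hM1, fun X _ _ hX x => ?_⟩
    have hM0 : (0:ℝ) < M := by exact_mod_cast hM1
    have hQ := Q_bound (fun i => ‖x i‖) (fun i => norm_nonneg _) s p s (by linarith) le_rfl (by linarith)
    have hL := Q_bound (fun i => ‖x i‖) (fun i => norm_nonneg _) 1 p 1 (by linarith) le_rfl (by linarith)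
    simp only [Real.rpow_one, div_one] at hL
    have hty := hX M x
    set E2 := cubeAvg (fun δ : Fin M → Bool => ‖∑ j, rad (δ j) • x j‖ ^ (2 : ℝ)) with hE2
    have hE20 : 0 ≤ E2 := cubeAvg_nonneg fun ε => by positivity
    set Lsum := ∑ i, ‖x i‖ with hLs
    set Q := (∑ i, ‖x i‖ ^ s) ^ (1 / s) with hQd
    set S := ∑ i, ‖x i‖ ^ p with hS
    have hL0 : 0 ≤ Lsum := Finset.sum_nonneg fun i _ => norm_nonneg _
    have hQ0 : 0 ≤ Q := by positivity
    have hS0 : 0 ≤ S := Finset.sum_nonneg fun i _ => by positivity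
    have hE : cubeAvg (fun θ : Fin M → Bool => ‖∑ i, rad (θ i) • x i‖ ^ p) ≤ Lsum ^ (p - 2) * E2 := by
      rw [hE2, ← cubeAvg_const_mul]
      refine cubeAvg_mono fun θ => ?_
      have hle : ‖∑ i, rad (θ i) • x i‖ ≤ Lsum := by
        refine (norm_sum_le _ _).trans (le_of_eq ?_)
        refine Finset.sum_congr rfl fun i _ => ?_
        rw [norm_smul, Real.norm_eq_abs, abs_rad, one_mul]
      calc ‖∑ i, rad (θ i) • x i‖ ^ p =
          ‖∑ i, rad (θ i) • x i‖ ^ (p - 2) * ‖∑ i, rad (θ i) • x i‖ ^ (2:ℝ) := by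
            rw [← Real.rpow_add_of_nonneg (norm_nonneg _) (by linarith) (by norm_num)]
            congr 1; ring
        _ ≤ _ := by
          have : 0 ≤ p - 2 := by linarith
          gcongr
    have hE2Q : E2 ≤ T ^ (2:ℝ) * Q ^ (2:ℝ) := by
      rw [← Real.mul_rpow hT.le hQ0]
      have := Real.rpow_le_rpow (by positivity) hty (by norm_num : (0:ℝ) ≤ 2)
      rw [← Real.rpow_mul hE20] at this
      norm_num at this
      norm_num
      exact this
    have h1 : Lsum ^ (p - 2) ≤ ((M:ℝ) ^ (p - 1) * S) ^ ((p - 2) / p) := by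
      have := Real.rpow_le_rpow (by positivity) hL (by
        apply div_nonneg <;> linarith : 0 ≤ (p - 2) / p)
      rw [← Real.rpow_mul hL0] at this
      convert this using 2
      field_simp
    have h2 : Q ^ (2:ℝ) ≤ ((M:ℝ) ^ (p / s - 1) * S) ^ (2 / p) := by
      have := Real.rpow_le_rpow (by positivity) hQ (by positivity : 0 ≤ 2 / p)
      rw [← Real.rpow_mul hQ0] at this
      convert this using 2
      field_simp
    have hprod : ((M:ℝ) ^ (p - 1) * S) ^ ((p - 2) / p) * ((M:ℝ) ^ (p / s - 1) * S) ^ (2 / p) =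
        (M:ℝ) ^ (p - 3 + 2 / s) * S := by
      rw [Real.mul_rpow (by positivity) hS0, Real.mul_rpow (by positivity) hS0,
        ← Real.rpow_mul hM0.le, ← Real.rpow_mul hM0.le]
      have e : S ^ ((p - 2) / p) * S ^ (2 / p) = S := by
        rw [← Real.rpow_add_of_nonneg hS0 (div_nonneg (by linarith) (by linarith)) (by positivity)]
        have : (p - 2) / p + 2 / p = 1 := by field_simp; ring
        rw [this, Real.rpow_one]
      calc _ = ((M:ℝ) ^ ((p - 1) * ((p - 2) / p)) * (M:ℝ) ^ ((p / s - 1) * (2 / p))) *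
            (S ^ ((p - 2) / p) * S ^ (2 / p)) := by ring
        _ = _ := by
          rw [e, ← Real.rpow_add hM0]
          congr 2
          field_simp
          ring
    calc _ ≤ Lsum ^ (p - 2) * E2 := hE
      _ ≤ Lsum ^ (p - 2) * (T ^ (2:ℝ) * Q ^ (2:ℝ)) := by gcongr
      _ = T ^ (2:ℝ) * (Lsum ^ (p - 2) * Q ^ (2:ℝ)) := by ring
      _ ≤ T ^ (2:ℝ) * (((M:ℝ) ^ (p - 1) * S) ^ ((p - 2) / p) *
            ((M:ℝ) ^ (p / s - 1) * S) ^ (2 / p)) := by gcongr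
      _ = (1 / 2) ^ p * (T ^ (2:ℝ) * 2 ^ p) * (M:ℝ) ^ (p - 3 + 2 / s) * S := by
        rw [hprod, Real.div_rpow (by norm_num) (by norm_num), Real.one_rpow]
        field_simp
      _ ≤ (1 / 2) ^ p * (M:ℝ) ^ (2 - 2 / s) * (M:ℝ) ^ (p - 3 + 2 / s) * S := by gcongr
      _ = _ := by
        rw [mul_assoc ((1 / 2 : ℝ) ^ p), ← Real.rpow_add hM0]
        congr 3; ring

end StarSec

section LemmaP

lemma prod_expand {M : ℕ} (x : Fin M → ℝ) (i : Fin M) (g : Bool → ℝ) :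
    ∑ θ : Fin M → Bool, (∏ k, (rad (θ k) * (if θ k then 1 else x k))) * g (θ i) =
      ∏ k, (if k = i then g true - x k * g false else 1 - x k) := by
  have h := Fintype.prod_sum (fun (k : Fin M) (b : Bool) =>
    (rad b * (if b then 1 else x k)) * (if k = i then g b else 1))
  have e1 : ∀ k : Fin M, ∑ b : Bool, (rad b * (if b then 1 else x k)) * (if k = i then g b else 1) =
      (if k = i then g true - x k * g false else 1 - x k) := by
    intro k
    simp only [Fintype.sum_bool, rad]
    by_cases hk : k = i
    · simp [hk]; ring
    · simp [hk]; ring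
  simp only [e1] at h
  rw [h]
  refine Finset.sum_congr rfl fun θ _ => ?_
  have e2 : ∏ k, (if k = i then g (θ k) else 1) = g (θ i) := by
    rw [Finset.prod_ite_eq' univ i (fun k => g (θ k))]
    simp
  rw [← e2, ← Finset.prod_mul_distrib]

lemma prod_expand' {M : ℕ} (x : Fin M → ℝ) :
    ∑ θ : Fin M → Bool, (∏ k, (rad (θ k) * (if θ k then 1 else x k))) = ∏ k, (1 - x k) := by
  have h := Fintype.prod_sum (fun (k : Fin M) (b : Bool) =>
    (rad b * (if b then 1 else x k)))
  rw [← h]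
  refine Finset.prod_congr rfl fun k _ => ?_
  simp [rad]; ring

lemma lemmaP_scalar {M : ℕ} (x : Fin M → ℝ) (hx : ∀ i, x i * x i = x i) :
    (M : ℝ) * ∏ k, (1 - x k) =
      ∑ θ : Fin M → Bool, ((∏ k, rad (θ k)) * (∑ i, if θ i then 1 else 0)) *
        (∏ k, (if θ k then 1 else x k)) +
      ∑ θ : Fin M → Bool, (-(1/2) * ∏ k, rad (θ k)) * ((∏ k, (if θ k then 1 else x k)) *
        ∑ i, rad (θ i) * x i) := by
  have key : ∀ i : Fin M, ∏ k, (1 - x k) =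
      ∑ θ : Fin M → Bool, (∏ k, (rad (θ k) * (if θ k then 1 else x k))) * (if θ i then 1 else 0) +
      ∑ θ : Fin M → Bool, (∏ k, (rad (θ k) * (if θ k then 1 else x k))) *
        (-(1/2) * rad (θ i) * x i) := by
    intro i
    have e2 := prod_expand x i (fun b => if b then 1 else 0)
    have e3 := prod_expand x i (fun b => (-(1/2) * rad b * x i))
    have e4 := prod_expand x i (fun b => if b then 0 else 1)
    have e5 := prod_expand x i (fun b => 1)
    simp only [mul_one] at e5
    have e6 : (∏ k, (if k = i then (1:ℝ) - x k else 1 - x k)) = ∏ k, (1 - x k) := by simp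
    rw [e6] at e5
    have e7 : ∏ k, (if k = i then (fun b => (-(1/2) * rad b * x i)) true -
        x k * (fun b => (-(1/2) * rad b * x i)) false else 1 - x k) =
        ∏ k, (if k = i then (fun b : Bool => if b then (0:ℝ) else 1) true -
        x k * (fun b : Bool => if b then (0:ℝ) else 1) false else 1 - x k) := by
      refine Finset.prod_congr rfl fun k _ => ?_
      split_ifs with hk
      · subst hk
        simp [rad]
        linear_combination (-(1/2)) * hx k
      · rfl
    rw [e3, e7, ← e4, ← e5, ← Finset.sum_add_distrib]
    refine Finset.sum_congr rfl fun θ _ => ?_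
    split_ifs <;> ring
  have h2 : (M : ℝ) * ∏ k, (1 - x k) = ∑ i : Fin M, ∏ k, (1 - x k) := by simp
  rw [h2, Finset.sum_congr rfl fun i _ => key i, Finset.sum_add_distrib]
  congr 1
  · rw [Finset.sum_comm]
    refine Finset.sum_congr rfl fun θ _ => ?_
    rw [← Finset.mul_sum, Finset.prod_mul_distrib]
    ring
  · rw [Finset.sum_comm]
    refine Finset.sum_congr rfl fun θ _ => ?_
    rw [← Finset.mul_sum, Finset.prod_mul_distrib]
    have : ∑ i, -(1/2) * rad (θ i) * x i = -(1/2) * ∑ i, rad (θ i) * x i := by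
      rw [Finset.mul_sum]; simp only [mul_assoc]
    rw [this]; ring

lemma sum_count (M : ℕ) : ∑ θ : Fin M → Bool, (∑ i, if θ i then (1:ℝ) else 0) = M * (2 ^ M / 2) := by
  rw [Finset.sum_comm]
  have h : ∀ i : Fin M, ∑ θ : Fin M → Bool, (if θ i then (1:ℝ) else 0) = 2 ^ M / 2 := by
    intro i
    have h := Fintype.prod_sum (fun (k : Fin M) (b : Bool) =>
      (if k = i then (if b then (1:ℝ) else 0) else 1))
    have e : ∀ θ : Fin M → Bool, ∏ k, (if k = i then (if θ k then (1:ℝ) else 0) else 1) =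
      if θ i then (1:ℝ) else 0 := by intro θ; simp
    simp only [e] at h
    rw [← h]
    have e2 : ∀ k : Fin M, ∑ b : Bool, (if k = i then (if b then (1:ℝ) else 0) else 1) =
      2 * (if k = i then 1/2 else 1) := by intro k; split_ifs <;> simp
    simp only [e2, Finset.prod_mul_distrib]
    simp; ring
  simp only [h]; simp

lemma star_avg {E : Type*} [NormedAddCommGroup E] [NormedSpace ℝ E] {M : ℕ} (hM : 1 ≤ M) {p : ℝ}
    (hp : 1 < p) (hE : StarP E M p) (y : Fin M → E) (c : ℝ) (hc : 0 ≤ c) (hy : ∀ i, ‖y i‖ ≤ c) :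
    ∑ θ : Fin M → Bool, ‖∑ i, rad (θ i) • y i‖ ≤ 2 ^ M * (M / 2 * c) := by
  have h1 := cubeAvg_rpow_le (fun θ : Fin M → Bool => ‖∑ i, rad (θ i) • y i‖)
    (fun _ => norm_nonneg _) p hp.le
  have hM0 : (0:ℝ) < M := by exact_mod_cast hM
  have h2 : (cubeAvg (fun θ : Fin M → Bool => ‖∑ i, rad (θ i) • y i‖)) ^ p ≤ (M / 2 * c) ^ p := by
    refine h1.trans ((hE y).trans ?_)
    have : ∑ i, ‖y i‖ ^ p ≤ ∑ i : Fin M, c ^ p := Finset.sum_le_sum fun i _ => by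
      have := hy i
      gcongr
    calc _ ≤ (1 / 2) ^ p * (M : ℝ) ^ (p - 1) * ∑ i : Fin M, c ^ p := by gcongr
      _ = _ := by
        rw [Finset.sum_const, Finset.card_univ, Fintype.card_fin, nsmul_eq_mul,
          Real.mul_rpow (by positivity) hc, Real.div_rpow hM0.le (by norm_num),
          Real.rpow_sub_one hM0.ne', Real.div_rpow (by norm_num) (by norm_num), Real.one_rpow]
        field_simp
  have h0 : 0 ≤ cubeAvg (fun θ : Fin M → Bool => ‖∑ i, rad (θ i) • y i‖) :=
    cubeAvg_nonneg fun _ => norm_nonneg _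
  have h3 := (Real.rpow_le_rpow_iff h0 (by positivity) (by linarith)).1 h2
  unfold cubeAvg at h3
  rw [smul_eq_mul, inv_mul_le_iff₀ (by positivity)] at h3
  exact h3

lemma lemmaP {ι E : Type*} [NormedAddCommGroup E] [NormedSpace ℝ E] {M : ℕ} (hM : 1 ≤ M) {p : ℝ}
    (hp : 1 < p) (hE : StarP E M p) (Ψ : (ι → ℝ) →ₐ[ℝ] (E →L[ℝ] E)) (e : Fin M → ι → ℝ)
    (he : ∀ i, e i * e i = e i) (hn : ∀ i, ‖Ψ (e i)‖ ≤ 1) :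
    ‖Ψ (∏ k, (1 - e k))‖ ≤ 3 / 4 * 2 ^ M := by
  have hM0 : (0:ℝ) < M := by exact_mod_cast hM
  have hprod : ∀ θ : Fin M → Bool, ∀ x, ‖Ψ (∏ k, (if θ k then 1 else e k)) x‖ ≤ ‖x‖ := by
    intro θ
    suffices h : ∀ s : Finset (Fin M), ∀ x, ‖Ψ (∏ k ∈ s, (if θ k then 1 else e k)) x‖ ≤ ‖x‖ from h _
    intro s
    induction s using Finset.induction_on with
    | empty => intro x; simp
    | insert a s ha ih =>
      intro x
      rw [Finset.prod_insert ha, map_mul, ContinuousLinearMap.mul_apply]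
      split_ifs
      · simpa using ih x
      · refine (ContinuousLinearMap.le_of_opNorm_le _ (hn a) _).trans ?_
        rw [one_mul]; exact ih x
  have hid : (M:ℝ) • (∏ k, (1 - e k)) =
      ∑ θ : Fin M → Bool, ((∏ k, rad (θ k)) * (∑ i, if θ i then (1:ℝ) else 0)) •
        (∏ k, (if θ k then 1 else e k)) +
      ∑ θ : Fin M → Bool, (-(1/2) * ∏ k, rad (θ k)) • ((∏ k, (if θ k then 1 else e k)) *
        ∑ i, rad (θ i) • e i) := by
    ext a
    have := lemmaP_scalar (fun k => e k a) (fun i => congrFun (he i) a)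
    simp only [Pi.smul_apply, Pi.add_apply, Finset.sum_apply, Finset.prod_apply, Pi.mul_apply,
      smul_eq_mul, Pi.sub_apply, Pi.one_apply, apply_ite (fun f : ι → ℝ => f a)]
    exact this
  refine ContinuousLinearMap.opNorm_le_bound _ (by positivity) fun x => ?_
  have habs : ∀ θ : Fin M → Bool, |∏ k, rad (θ k)| = 1 := fun θ => by
    rw [Finset.abs_prod]; simp [abs_rad]
  have h1 : (M:ℝ) * ‖Ψ (∏ k, (1 - e k)) x‖ ≤ M * (3 / 4 * 2 ^ M * ‖x‖) := by
    calc (M:ℝ) * ‖Ψ (∏ k, (1 - e k)) x‖ = ‖Ψ ((M:ℝ) • ∏ k, (1 - e k)) x‖ := by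
          rw [map_smul, ContinuousLinearMap.smul_apply, norm_smul, Real.norm_of_nonneg hM0.le]
      _ ≤ ∑ θ : Fin M → Bool, (∑ i, if θ i then (1:ℝ) else 0) * ‖x‖ +
          ∑ θ : Fin M → Bool, 1/2 * ‖∑ i, rad (θ i) • Ψ (e i) x‖ := by
        rw [hid, map_add, map_sum, map_sum, ContinuousLinearMap.add_apply,
          ContinuousLinearMap.sum_apply, ContinuousLinearMap.sum_apply]
        refine (norm_add_le _ _).trans (add_le_add ?_ ?_)
        · refine (norm_sum_le _ _).trans (Finset.sum_le_sum fun θ _ => ?_)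
          rw [map_smul, ContinuousLinearMap.smul_apply, norm_smul, norm_mul, Real.norm_eq_abs,
            habs, one_mul, Real.norm_of_nonneg (Finset.sum_nonneg fun i _ => by split_ifs <;> norm_num)]
          exact mul_le_mul_of_nonneg_left (hprod θ x)
            (Finset.sum_nonneg fun i _ => by split_ifs <;> norm_num)
        · refine (norm_sum_le _ _).trans (Finset.sum_le_sum fun θ _ => ?_)
          rw [map_smul, ContinuousLinearMap.smul_apply, norm_smul, norm_mul, Real.norm_eq_abs,
            Real.norm_eq_abs, habs, mul_one, abs_neg, abs_of_pos (by norm_num : (0:ℝ) < 1/2),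
            map_mul, ContinuousLinearMap.mul_apply]
          refine mul_le_mul_of_nonneg_left ((hprod θ _).trans (le_of_eq ?_)) (by norm_num)
          rw [map_sum, ContinuousLinearMap.sum_apply]
          simp only [map_smul, ContinuousLinearMap.smul_apply]
      _ ≤ M * (2 ^ M / 2) * ‖x‖ + 1/2 * (2 ^ M * (M / 2 * ‖x‖)) := by
        rw [← Finset.sum_mul, sum_count, ← Finset.mul_sum]
        gcongr
        refine star_avg hM hp hE _ _ (norm_nonneg _) fun i => ?_
        simpa using ContinuousLinearMap.le_of_opNorm_le _ (hn i) x
      _ = _ := by ring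
  exact le_of_mul_le_mul_left h1 hM0

end LemmaP

section KernelOps

variable {ι : Type*} [Fintype ι] [DecidableEq ι] {X : Type*} [NormedAddCommGroup X] [NormedSpace ℝ X]
  (q : ENNReal) [Fact (1 ≤ q)]

/-- Operator on `ℓ^q(ι; X)` with a scalar kernel. -/
def kerL (k : Matrix ι ι ℝ) : PiLp q (fun _ : ι => X) →L[ℝ] PiLp q (fun _ : ι => X) :=
  ((PiLp.continuousLinearEquiv q ℝ (fun _ : ι => X)).symm : (ι → X) →L[ℝ] PiLp q (fun _ : ι => X)).comp
    ((ContinuousLinearMap.pi fun ε => ∑ η, k ε η • ContinuousLinearMap.proj η).comp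
      ((PiLp.continuousLinearEquiv q ℝ (fun _ : ι => X)) : PiLp q (fun _ : ι => X) →L[ℝ] (ι → X)))

lemma kerL_apply (k : Matrix ι ι ℝ) (y : PiLp q (fun _ : ι => X)) (ε : ι) :
    kerL q k y ε = ∑ η, k ε η • y η := by
  simp [kerL]

/-- Kernel operators form an algebra homomorphism. -/
def kerAlg : Matrix ι ι ℝ →ₐ[ℝ] (PiLp q (fun _ : ι => X) →L[ℝ] PiLp q (fun _ : ι => X)) :=
  AlgHom.ofLinearMap
    { toFun := kerL q
      map_add' := by
        intro a b
        ext y ε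
        simp [kerL_apply, add_smul, Finset.sum_add_distrib]
      map_smul' := by
        intro c a
        ext y ε
        simp [kerL_apply, mul_smul, Finset.smul_sum] }
    (by
      ext y ε
      simp [kerL_apply, Matrix.one_apply])
    (by
      intro a b
      ext y ε
      simp only [LinearMap.coe_mk, AddHom.coe_mk, kerL_apply, ContinuousLinearMap.mul_apply,
        Matrix.mul_apply, Finset.sum_smul, Finset.smul_sum, mul_smul]
      rw [Finset.sum_comm])

lemma kerAlg_apply (k : Matrix ι ι ℝ) (y : PiLp q (fun _ : ι => X)) (ε : ι) :
    kerAlg q k y ε = ∑ η, k ε η • y η := kerL_apply q k y ε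

end KernelOps

section PiLpNorm

variable {ι : Type*} [Fintype ι] {X : Type*} [NormedAddCommGroup X] [NormedSpace ℝ X]

lemma pilp_norm_rpow {p : ℝ} (hp : 1 < p) (y : PiLp (ENNReal.ofReal p) (fun _ : ι => X)) :
    ‖y‖ ^ p = ∑ i, ‖y i‖ ^ p := by
  have h1 : (ENNReal.ofReal p).toReal = p := ENNReal.toReal_ofReal (by linarith)
  have hf : 0 < (ENNReal.ofReal p).toReal := by rw [h1]; linarith
  rw [PiLp.norm_eq_sum hf, h1, ← Real.rpow_mul (Finset.sum_nonneg fun i _ => by positivity)]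
  rw [one_div_mul_cancel (by linarith), Real.rpow_one]

lemma fact_ofReal {p : ℝ} (hp : 1 < p) : Fact (1 ≤ ENNReal.ofReal p) :=
  ⟨by rw [ENNReal.one_le_ofReal]; exact hp.le⟩

lemma star_pilp {M : ℕ} {p : ℝ} (hp : 1 < p) [Fact (1 ≤ ENNReal.ofReal p)] (hX : StarP X M p) :
    StarP (PiLp (ENNReal.ofReal p) (fun _ : ι => X)) M p := by
  intro y
  simp only [pilp_norm_rpow hp]
  have h1 : cubeAvg (fun θ : Fin M → Bool => ∑ i, ‖(∑ j, rad (θ j) • y j) i‖ ^ p) =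
      ∑ i, cubeAvg (fun θ : Fin M → Bool => ‖∑ j, rad (θ j) • y j i‖ ^ p) := by
    simp only [cubeAvg, ← Finset.smul_sum]
    rw [Finset.sum_comm]
    simp
  rw [h1, Finset.sum_comm, Finset.mul_sum]
  exact Finset.sum_le_sum fun i _ => hX fun j => y j i

/-- Markov kernels are contractions. -/
lemma kernel_contract (k : ι → ι → ℝ) (hk : ∀ a b, 0 ≤ k a b) (hr : ∀ a, ∑ b, k a b = 1)
    (hc : ∀ b, ∑ a, k a b = 1) {p : ℝ} (hp : 1 < p) (f : ι → X) :
    ∑ a, ‖∑ b, k a b • f b‖ ^ p ≤ ∑ b, ‖f b‖ ^ p := by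
  calc ∑ a, ‖∑ b, k a b • f b‖ ^ p ≤ ∑ a, ∑ b, k a b * ‖f b‖ ^ p := by
        refine Finset.sum_le_sum fun a _ => ?_
        have h1 : ‖∑ b, k a b • f b‖ ≤ ∑ b, k a b * ‖f b‖ := by
          refine (norm_sum_le _ _).trans (le_of_eq (Finset.sum_congr rfl fun b _ => ?_))
          rw [norm_smul, Real.norm_of_nonneg (hk a b)]
        refine (Real.rpow_le_rpow (norm_nonneg _) h1 (by linarith)).trans ?_
        exact Real.rpow_arith_mean_le_arith_mean_rpow univ (k a) (fun b => ‖f b‖)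
          (fun b _ => hk a b) (hr a) (fun b _ => norm_nonneg _) hp.le
    _ = ∑ b, ‖f b‖ ^ p := by
      rw [Finset.sum_comm]
      refine Finset.sum_congr rfl fun b _ => ?_
      rw [← Finset.sum_mul, hc, one_mul]

lemma kerAlg_contract [DecidableEq ι] {p : ℝ} (hp : 1 < p) [Fact (1 ≤ ENNReal.ofReal p)]
    (k : Matrix ι ι ℝ) (hk : ∀ a b, 0 ≤ k a b) (hr : ∀ a, ∑ b, k a b = 1)
    (hc : ∀ b, ∑ a, k a b = 1) :
    ‖(kerAlg (ENNReal.ofReal p) k : PiLp (ENNReal.ofReal p) (fun _ : ι => X) →L[ℝ] _)‖ ≤ 1 := by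
  refine ContinuousLinearMap.opNorm_le_bound _ zero_le_one fun y => ?_
  rw [one_mul, ← Real.rpow_le_rpow_iff (norm_nonneg _) (norm_nonneg _) (by linarith : 0 < p),
    pilp_norm_rpow hp, pilp_norm_rpow hp]
  simp only [kerAlg_apply]
  exact kernel_contract k hk hr hc hp _

end PiLpNorm

section Walsh

variable {n : ℕ}

lemma walsh_prod (A : Finset (Fin n)) (ε : Fin n → Bool) :
    walshChar A ε = ∏ i, (if i ∈ A then rad (ε i) else 1) := by
  unfold walshChar
  rw [Finset.prod_ite_mem, Finset.univ_inter]

/-- summing a product over all subsets. -/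
lemma sum_subsets_prod (x y : Fin n → ℝ) :
    ∑ A : Finset (Fin n), (∏ i, (if i ∈ A then x i else y i)) = ∏ i, (x i + y i) := by
  rw [Finset.prod_add, Finset.powerset_univ]
  refine Finset.sum_congr rfl fun A _ => ?_
  rw [Finset.prod_ite]
  congr 1
  · congr 1; ext; simp
  · congr 1; ext; simp

/-- Walsh matrices -/
def wU (n : ℕ) : Matrix (Fin n → Bool) (Finset (Fin n)) ℝ := fun ε A => walshChar A ε

def wV (n : ℕ) : Matrix (Finset (Fin n)) (Fin n → Bool) ℝ := fun A ε => (2 ^ n : ℝ)⁻¹ * walshChar A ε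

lemma walsh_kernel (z : Fin n → ℝ) (ε η : Fin n → Bool) :
    ∑ A : Finset (Fin n), (∏ i ∈ A, z i) * (walshChar A ε * walshChar A η) =
      ∏ i, (1 + z i * (rad (ε i) * rad (η i))) := by
  have h := sum_subsets_prod (fun i => z i * (rad (ε i) * rad (η i))) (fun _ => 1)
  rw [Finset.prod_congr rfl fun i _ => add_comm (1:ℝ) _, ← h]
  refine Finset.sum_congr rfl fun A _ => ?_
  unfold walshChar
  rw [← Finset.prod_mul_distrib, ← Finset.prod_mul_distrib, Finset.prod_ite_mem, Finset.univ_inter]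

lemma one_add_rad (b c : Bool) : 1 + rad b * rad c = if b = c then 2 else 0 := by
  cases b <;> cases c <;> norm_num [rad]

lemma wU_mul_wV : wU n * wV n = 1 := by
  ext ε η
  rw [Matrix.mul_apply]
  have h := walsh_kernel (fun _ => 1) ε η
  simp only [Finset.prod_const_one, one_mul, one_add_rad] at h
  have e : ∀ A, wU n ε A * wV n A η = (2 ^ n : ℝ)⁻¹ * (walshChar A ε * walshChar A η) := by
    intro A; simp only [wU, wV]; ring
  simp only [e, ← Finset.mul_sum, h, Matrix.one_apply]
  split_ifs with hh
  · subst hh; simp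
  · obtain ⟨i, hi⟩ := Function.ne_iff.1 hh
    rw [Finset.prod_eq_zero (mem_univ i) (by simp [hi])]; simp

lemma wV_mul_wU : wV n * wU n = 1 := by
  have hcard : Fintype.card (Fin n → Bool) = Fintype.card (Finset (Fin n)) := by simp
  exact (Matrix.mul_eq_one_comm_of_card_eq _ _ _ hcard).1 wU_mul_wV

/-- Walsh multipliers as matrices -/
def wMat (n : ℕ) : (Finset (Fin n) → ℝ) →ₐ[ℝ] Matrix (Fin n → Bool) (Fin n → Bool) ℝ :=
  AlgHom.ofLinearMap
    { toFun := fun m => wU n * Matrix.diagonal m * wV n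
      map_add' := by
        intro a b
        have : Matrix.diagonal (a + b) = Matrix.diagonal a + Matrix.diagonal b :=
          (Matrix.diagonal_add a b).symm
        rw [this, Matrix.mul_add, Matrix.add_mul]
      map_smul' := by
        intro c a
        rw [Matrix.diagonal_smul, Matrix.mul_smul, Matrix.smul_mul]; rfl }
    (by
      simp [wU_mul_wV])
    (by
      intro a b
      simp only [LinearMap.coe_mk, AddHom.coe_mk]
      have : wU n * Matrix.diagonal a * wV n * (wU n * Matrix.diagonal b * wV n) =
        wU n * Matrix.diagonal a * (wV n * wU n) * Matrix.diagonal b * wV n := by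
        simp only [Matrix.mul_assoc]
      have h2 : Matrix.diagonal (a * b) = Matrix.diagonal a * Matrix.diagonal b :=
        (Matrix.diagonal_mul_diagonal a b).symm
      rw [this, wV_mul_wU, Matrix.mul_one, h2]
      simp only [Matrix.mul_assoc])

lemma wMat_apply (m : Finset (Fin n) → ℝ) (ε η : Fin n → Bool) :
    wMat n m ε η = (2 ^ n : ℝ)⁻¹ * ∑ A, m A * (walshChar A ε * walshChar A η) := by
  change (wU n * Matrix.diagonal m * wV n) ε η = _
  rw [Matrix.mul_apply, Finset.mul_sum]
  refine Finset.sum_congr rfl fun A _ => ?_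
  rw [Matrix.mul_diagonal]
  simp only [wU, wV]; ring

end Walsh

section RadProj

variable {n : ℕ}

/-- The symbol of the conditional expectation that averages the coordinates in `b`. -/
def eSym (b : Fin n → Bool) : Finset (Fin n) → ℝ := fun A => ∏ j ∈ A, (if b j then 0 else 1)

lemma eSym_idem (b : Fin n → Bool) : eSym b * eSym b = eSym b := by
  ext A
  simp only [Pi.mul_apply, eSym, ← Finset.prod_mul_distrib]
  refine Finset.prod_congr rfl fun j _ => ?_
  split_ifs <;> simp

lemma sum_cube_prod (g : Fin n → Bool → ℝ) :
    ∑ η : Fin n → Bool, ∏ i, g i (η i) = ∏ i, (g i true + g i false) := by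
  rw [← Fintype.prod_sum]
  simp

lemma eSym_contract {X : Type*} [NormedAddCommGroup X] [NormedSpace ℝ X] {p : ℝ} (hp : 1 < p)
    [Fact (1 ≤ ENNReal.ofReal p)] (b : Fin n → Bool) :
    ‖(kerAlg (ENNReal.ofReal p) (wMat n (eSym b)) :
      PiLp (ENNReal.ofReal p) (fun _ : Fin n → Bool => X) →L[ℝ] _)‖ ≤ 1 := by
  have hker : ∀ ε η, wMat n (eSym b) ε η =
      (2 ^ n : ℝ)⁻¹ * ∏ i, (1 + (if b i then 0 else 1) * (rad (ε i) * rad (η i))) := by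
    intro ε η
    rw [wMat_apply]
    congr 1
    exact walsh_kernel (fun j => if b j then 0 else 1) ε η
  have hsymm : ∀ ε η, wMat n (eSym b) ε η = wMat n (eSym b) η ε := by
    intro ε η; rw [hker, hker]; simp only [mul_comm (rad (ε _))]
  have hrow : ∀ ε, ∑ η, wMat n (eSym b) ε η = 1 := by
    intro ε
    simp only [hker, ← Finset.mul_sum]
    rw [sum_cube_prod (fun i c => (1 + (if b i then 0 else 1) * (rad (ε i) * rad c)))]
    have : ∀ i, ((1 + (if b i then 0 else 1) * (rad (ε i) * rad true)) +
      (1 + (if b i then 0 else 1) * (rad (ε i) * rad false))) = (2:ℝ) := by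
      intro i; simp [rad]; ring
    simp only [this]; simp
  refine kerAlg_contract hp _ ?_ hrow ?_
  · intro ε η
    rw [hker]
    refine mul_nonneg (by positivity) (Finset.prod_nonneg fun i _ => ?_)
    split_ifs
    · simp
    · rw [one_mul, one_add_rad]; split_ifs <;> norm_num
  · intro η
    simp only [hsymm _ η]; exact hrow η

/-- Product weights -/
def bw (ρ : ℝ) (b : Fin n → Bool) : ℝ := ∏ j, (if b j then 1 - ρ else ρ)

lemma bw_nonneg {ρ : ℝ} (h0 : 0 ≤ ρ) (h1 : ρ ≤ 1) (b : Fin n → Bool) : 0 ≤ bw ρ b :=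
  Finset.prod_nonneg fun j _ => by split_ifs <;> linarith

lemma bw_sum (ρ : ℝ) : ∑ b : Fin n → Bool, bw ρ b = 1 := by
  unfold bw
  rw [sum_cube_prod (fun _ c => if c then 1 - ρ else ρ)]
  simp

lemma bw_eSym (ρ : ℝ) (A : Finset (Fin n)) : ∑ b : Fin n → Bool, bw ρ b * eSym b A = ρ ^ A.card := by
  have e : ∀ b : Fin n → Bool, bw ρ b * eSym b A =
      ∏ j, ((if b j then 1 - ρ else ρ) * (if j ∈ A then (if b j then 0 else 1) else 1)) := by
    intro b
    rw [Finset.prod_mul_distrib, Finset.prod_ite_mem, Finset.univ_inter]; rfl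
  simp only [e]
  rw [sum_cube_prod (fun j c => ((if c then 1 - ρ else ρ) * (if j ∈ A then (if c then 0 else 1) else 1)))]
  have e2 : ∀ j : Fin n, (((if true then 1 - ρ else ρ) * (if j ∈ A then (if true then 0 else 1) else 1)) +
      ((if false then 1 - ρ else ρ) * (if j ∈ A then (if false then 0 else 1) else 1))) =
      if j ∈ A then ρ else 1 := by
    intro j; split_ifs <;> simp_all
  have := Finset.prod_congr (s₁ := univ) rfl fun j _ => e2 j
  refine this.trans ?_
  rw [Finset.prod_ite_mem, Finset.univ_inter, Finset.prod_const]

lemma one_sub_pow_expand (ρ : ℝ) (M : ℕ) (A : Finset (Fin n)) :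
    (1 - ρ ^ A.card) ^ M = ∑ β : Fin M → (Fin n → Bool), (∏ i, bw ρ (β i)) *
      ∏ i, (1 - eSym (β i) A) := by
  rw [← bw_eSym, ← bw_sum (n := n) ρ, ← Finset.sum_sub_distrib, Fintype.sum_pow]
  refine Finset.sum_congr rfl fun β _ => ?_
  rw [← Finset.prod_mul_distrib]
  refine Finset.prod_congr rfl fun i _ => ?_
  rw [bw_sum]; ring

/-- pullback of functions of the cardinality -/
def cardHom (n : ℕ) : (ℕ → ℝ) →ₐ[ℝ] (Finset (Fin n) → ℝ) :=
  AlgHom.ofLinearMap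
    { toFun := fun m A => m A.card
      map_add' := fun _ _ => rfl
      map_smul' := fun _ _ => rfl } rfl (fun _ _ => rfl)

lemma cardHom_apply (m : ℕ → ℝ) (A : Finset (Fin n)) : cardHom n m A = m A.card := rfl

lemma rad_proj_op (M : ℕ) (hM : 1 ≤ M) (p : ℝ) (hp : 1 < p) : ∃ K : ℝ, 0 < K ∧
    ∀ (X : Type*) [NormedAddCommGroup X] [NormedSpace ℝ X] [CompleteSpace X], StarP X M p →
    ∀ [Fact (1 ≤ ENNReal.ofReal p)] (n : ℕ),
    ‖(kerAlg (ENNReal.ofReal p) (wMat n (fun A => if A.card = 1 then 1 else 0)) :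
      PiLp (ENNReal.ofReal p) (fun _ : Fin n → Bool => X) →L[ℝ] _)‖ ≤ K := by
  obtain ⟨K, hK, h⟩ := kc_main M (by omega)
  refine ⟨K, hK, fun X _ _ _ hX _ n => ?_⟩
  set Y := PiLp (ENNReal.ofReal p) (fun _ : Fin n → Bool => X) with hY
  set Ψ : (Finset (Fin n) → ℝ) →ₐ[ℝ] (Y →L[ℝ] Y) := (kerAlg (ENNReal.ofReal p)).comp (wMat n) with hΨ
  have hΨe : ∀ b, ‖Ψ (eSym b)‖ ≤ 1 := fun b => eSym_contract hp b
  refine h (Y →L[ℝ] Y) (Ψ.comp (cardHom n)) (n + 1)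
    (fun k => Ψ (fun A => if A.card = k then 1 else 0)) ?_ ?_ ?_
  · intro m
    have e : cardHom n m = ∑ k ∈ range (n + 1), m k • (fun A : Finset (Fin n) =>
        if A.card = k then (1:ℝ) else 0) := by
      ext A
      rw [cardHom_apply]
      simp only [Finset.sum_apply, Pi.smul_apply, smul_eq_mul, mul_ite, mul_one, mul_zero]
      rw [Finset.sum_ite_eq, if_pos]
      have := Finset.card_le_univ A
      simp at this
      simp; omega
    rw [AlgHom.comp_apply, e, map_sum]
    simp only [map_smul]
  · intro ρ h0 h1
    have e : cardHom n (fun k => ρ ^ k) = ∑ b : Fin n → Bool, bw ρ b • eSym b := by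
      ext A
      rw [cardHom_apply, ← bw_eSym]; simp
    rw [AlgHom.comp_apply, e, map_sum]
    refine (norm_sum_le _ _).trans ?_
    rw [← bw_sum (n := n) ρ]
    refine Finset.sum_le_sum fun b _ => ?_
    rw [map_smul, norm_smul, Real.norm_of_nonneg (bw_nonneg h0 h1 b)]
    exact mul_le_of_le_one_right (bw_nonneg h0 h1 b) (hΨe b)
  · intro ρ h0 h1
    have e : cardHom n (fun k => (1 - ρ ^ k) ^ M) = ∑ β : Fin M → (Fin n → Bool),
        (∏ i, bw ρ (β i)) • ∏ i, (1 - eSym (β i)) := by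
      ext A
      rw [cardHom_apply, one_sub_pow_expand]; simp
    rw [AlgHom.comp_apply, e, map_sum]
    refine (norm_sum_le _ _).trans ?_
    have hs : ∑ β : Fin M → (Fin n → Bool), (∏ i, bw ρ (β i)) = 1 := by
      rw [← Fintype.sum_pow (fun b : Fin n → Bool => bw ρ b), bw_sum, one_pow]
    calc _ ≤ ∑ β : Fin M → (Fin n → Bool), (∏ i, bw ρ (β i)) * (3 / 4 * 2 ^ M) := by
          refine Finset.sum_le_sum fun β _ => ?_
          have hw : 0 ≤ ∏ i, bw ρ (β i) := Finset.prod_nonneg fun i _ => bw_nonneg h0 h1 _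
          rw [map_smul, norm_smul, Real.norm_of_nonneg hw]
          refine mul_le_mul_of_nonneg_left ?_ hw
          exact lemmaP hM hp (star_pilp hp hX) Ψ (fun i => eSym (β i)) (fun i => eSym_idem _)
            fun i => hΨe _
      _ = _ := by rw [← Finset.sum_mul, hs, one_mul]

lemma rad_kernel (ε η : Fin n → Bool) :
    wMat n (fun A => if A.card = 1 then 1 else 0) ε η =
      (2 ^ n : ℝ)⁻¹ * ∑ j, rad (ε j) * rad (η j) := by
  rw [wMat_apply]
  congr 1
  simp only [ite_mul, one_mul, zero_mul]
  rw [← Finset.sum_filter]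
  symm
  refine Finset.sum_bij (fun j _ => {j}) ?_ ?_ ?_ ?_
  · intro j _; simp
  · intro a _ b _ h; simpa using h
  · intro A hA
    obtain ⟨a, rfl⟩ := Finset.card_eq_one.1 (Finset.mem_filter.1 hA).2
    exact ⟨a, mem_univ _, rfl⟩
  · intro j _; simp [walshChar]

lemma rad_proj (M : ℕ) (hM : 1 ≤ M) (p : ℝ) (hp : 1 < p) : ∃ K : ℝ, 0 < K ∧
    ∀ (X : Type*) [NormedAddCommGroup X] [NormedSpace ℝ X] [CompleteSpace X], StarP X M p →
    ∀ (n : ℕ) (f : (Fin n → Bool) → X),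
      ∑ δ : Fin n → Bool, ‖∑ j, rad (δ j) • cubeAvg (fun η => rad (η j) • f η)‖ ^ p ≤
        K ^ p * ∑ δ, ‖f δ‖ ^ p := by
  obtain ⟨K, hK, h⟩ := rad_proj_op M hM p hp
  refine ⟨K, hK, fun X _ _ _ hX n f => ?_⟩
  haveI := fact_ofReal hp
  have h1 := h X hX n
  set y : PiLp (ENNReal.ofReal p) (fun _ : Fin n → Bool => X) := WithLp.toLp _ f with hy
  have h2 := ContinuousLinearMap.le_of_opNorm_le _ h1 y
  have h3 := Real.rpow_le_rpow (norm_nonneg _) h2 (by linarith : 0 ≤ p)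
  rw [Real.mul_rpow hK.le (norm_nonneg _), pilp_norm_rpow hp, pilp_norm_rpow hp] at h3
  refine le_trans (le_of_eq ?_) h3
  refine Finset.sum_congr rfl fun δ _ => ?_
  congr 2
  rw [kerAlg_apply]
  simp only [rad_kernel, cubeAvg, Finset.smul_sum, Finset.mul_sum, Finset.sum_smul]
  rw [Finset.sum_comm]
  refine Finset.sum_congr rfl fun η _ => Finset.sum_congr rfl fun j _ => ?_
  rw [smul_smul, smul_smul]
  congr 1; ring

end RadProj

section Decay

variable {n : ℕ} {X : Type*} [NormedAddCommGroup X] [NormedSpace ℝ X]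

/-- Unnormalised Rademacher moment. -/
def RS (p : ℝ) (z : Fin n → X) : ℝ := ∑ δ : Fin n → Bool, ‖∑ j, rad (δ j) • z j‖ ^ p

lemma RS_nonneg (p : ℝ) (z : Fin n → X) : 0 ≤ RS p z :=
  Finset.sum_nonneg fun _ _ => by positivity

lemma rad_beq (a b : Bool) : rad (a == b) = rad a * rad b := by
  cases a <;> cases b <;> simp [rad]

/-- sign change on the cube -/
def sgnEquiv (σ : Fin n → Bool) : (Fin n → Bool) ≃ (Fin n → Bool) where
  toFun δ := fun j => δ j == σ j
  invFun δ := fun j => δ j == σ j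
  left_inv δ := by ext j; cases h : δ j <;> cases h' : σ j <;> simp [h, h']
  right_inv δ := by ext j; cases h : δ j <;> cases h' : σ j <;> simp [h, h']

lemma RS_sign (p : ℝ) (σ : Fin n → Bool) (z : Fin n → X) :
    RS p (fun j => rad (σ j) • z j) = RS p z := by
  unfold RS
  rw [← Equiv.sum_comp (sgnEquiv σ) (fun δ => ‖∑ j, rad (δ j) • z j‖ ^ p)]
  refine Finset.sum_congr rfl fun δ _ => ?_
  simp only [sgnEquiv, Equiv.coe_fn_mk, rad_beq, smul_smul]

lemma RS_smul (p c : ℝ) (hc : 0 ≤ c) (z : Fin n → X) :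
    RS p (fun j => c • z j) = c ^ p * RS p z := by
  unfold RS
  rw [Finset.mul_sum]
  refine Finset.sum_congr rfl fun δ _ => ?_
  have : ∑ j, rad (δ j) • c • z j = c • ∑ j, rad (δ j) • z j := by
    rw [Finset.smul_sum]; simp only [smul_comm c]
  rw [this, norm_smul, Real.norm_of_nonneg hc, Real.mul_rpow hc (norm_nonneg _)]

lemma RS_contract {p : ℝ} (hp : 1 < p) (t : Fin n → ℝ) (ht : ∀ j, |t j| ≤ 1) (z : Fin n → X) :
    RS p (fun j => t j • z j) ≤ RS p z := by
  set lam : (Fin n → Bool) → ℝ := fun σ => ∏ j, ((1 + rad (σ j) * t j) / 2) with hlam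
  have hl0 : ∀ σ, 0 ≤ lam σ := fun σ => Finset.prod_nonneg fun j _ => by
    have := abs_le.1 (ht j)
    unfold rad; split_ifs <;> linarith
  have hl1 : ∑ σ, lam σ = 1 := by
    rw [hlam, sum_cube_prod (fun j c => ((1 + rad c * t j) / 2))]
    refine Finset.prod_eq_one fun j _ => ?_
    simp [rad]; ring
  have hlt : ∀ i, ∑ σ, lam σ * rad (σ i) = t i := by
    intro i
    have e : ∀ σ : Fin n → Bool, lam σ * rad (σ i) =
        ∏ j, (((1 + rad (σ j) * t j) / 2) * (if j = i then rad (σ j) else 1)) := by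
      intro σ
      rw [Finset.prod_mul_distrib, Finset.prod_ite_eq' univ i (fun k => rad (σ k))]
      simp [hlam]
    simp only [e]
    rw [sum_cube_prod (fun j c => (((1 + rad c * t j) / 2) * (if j = i then rad c else 1)))]
    have e2 : ∀ j, ((((1 + rad true * t j) / 2) * (if j = i then rad true else 1)) +
      (((1 + rad false * t j) / 2) * (if j = i then rad false else 1))) = if j = i then t j else 1 := by
      intro j; split_ifs <;> simp [rad] <;> ring
    simp only [e2]
    rw [Finset.prod_ite_eq' univ i t]; simp
  calc RS p (fun j => t j • z j) ≤ ∑ δ : Fin n → Bool, ∑ σ, lam σ *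
        ‖∑ j, rad (δ j) • rad (σ j) • z j‖ ^ p := by
        unfold RS
        refine Finset.sum_le_sum fun δ _ => ?_
        have e : ∑ j, rad (δ j) • t j • z j = ∑ σ, lam σ • ∑ j, rad (δ j) • rad (σ j) • z j := by
          simp only [Finset.smul_sum]
          rw [Finset.sum_comm]
          refine Finset.sum_congr rfl fun j _ => ?_
          rw [← hlt j, Finset.sum_smul, Finset.smul_sum]
          refine Finset.sum_congr rfl fun σ _ => ?_
          simp only [smul_smul]; congr 1; ring
        have h1 : ‖∑ j, rad (δ j) • t j • z j‖ ≤
            ∑ σ, lam σ * ‖∑ j, rad (δ j) • rad (σ j) • z j‖ := by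
          rw [e]
          refine (norm_sum_le _ _).trans (le_of_eq (Finset.sum_congr rfl fun b _ => ?_))
          rw [norm_smul, Real.norm_of_nonneg (hl0 _)]
        refine (Real.rpow_le_rpow (norm_nonneg _) h1 (by linarith)).trans ?_
        exact Real.rpow_arith_mean_le_arith_mean_rpow univ lam _
          (fun b _ => hl0 b) hl1 (fun b _ => norm_nonneg _) hp.le
    _ = ∑ σ, lam σ * RS p (fun j => rad (σ j) • z j) := by
      rw [Finset.sum_comm]
      simp only [RS, Finset.mul_sum]
    _ = RS p z := by
      simp only [RS_sign]
      rw [← Finset.sum_mul, hl1, one_mul]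

/-- push-forward of product weights -/
lemma push_prod {α γ : Type*} [Fintype α] [Fintype γ] [DecidableEq γ] (w : α → ℝ) (g : α → γ)
    (Φ : (Fin n → γ) → ℝ) :
    ∑ l : Fin n → α, (∏ j, w (l j)) * Φ (fun j => g (l j)) =
      ∑ y : Fin n → γ, (∏ j, ∑ a, if g a = y j then w a else 0) * Φ y := by
  have e : ∀ y : Fin n → γ, (∏ j, ∑ a, if g a = y j then w a else 0) =
      ∑ l : Fin n → α, ∏ j, (if g (l j) = y j then w (l j) else 0) := fun y =>
    Fintype.prod_sum (fun j a => if g a = y j then w a else 0)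
  simp only [e, Finset.sum_mul]
  rw [Finset.sum_comm]
  refine Finset.sum_congr rfl fun l _ => ?_
  rw [Finset.sum_eq_single (fun j => g (l j))]
  · simp
  · intro y _ hy
    obtain ⟨j, hj⟩ := Function.ne_iff.1 hy
    rw [Finset.prod_eq_zero (mem_univ j) (by rw [if_neg]; exact fun h => hj h.symm), zero_mul]
  · simp

/-- Bernoulli weights -/
def bern (b : ℝ) (S : Fin n → Bool) : ℝ := ∏ j, (if S j then b else 1 - b)

lemma bern_nonneg {b : ℝ} (h0 : 0 ≤ b) (h1 : b ≤ 1) (S : Fin n → Bool) : 0 ≤ bern b S :=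
  Finset.prod_nonneg fun j _ => by split_ifs <;> linarith

lemma bern_sum (b : ℝ) : ∑ S : Fin n → Bool, bern b S = 1 := by
  unfold bern
  rw [sum_cube_prod (fun _ c => if c then b else 1 - b)]
  simp

/-- restriction of a sequence to a random subset -/
def restr (S : Fin n → Bool) (z : Fin n → X) : Fin n → X := fun j => (if S j then (1:ℝ) else 0) • z j

def PsiB (p b : ℝ) (z : Fin n → X) : ℝ := ∑ S : Fin n → Bool, bern b S * RS p (restr S z)

lemma RS_restr {p : ℝ} (hp : 1 < p) (S : Fin n → Bool) (z : Fin n → X) :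
    RS p (restr S z) ≤ RS p z :=
  RS_contract hp _ (fun j => by split_ifs <;> simp) z

lemma bern_one (S : Fin n → Bool) : bern 1 S = if S = (fun _ => true) then 1 else 0 := by
  unfold bern
  split_ifs with h
  · subst h; simp
  · obtain ⟨j, hj⟩ := Function.ne_iff.1 h
    exact Finset.prod_eq_zero (mem_univ j) (by simp [hj])

lemma PsiB_one (p : ℝ) (z : Fin n → X) : PsiB p 1 z = RS p z := by
  unfold PsiB
  simp only [bern_one, ite_mul, one_mul, zero_mul]
  rw [Finset.sum_ite_eq' univ (fun _ => true) (fun S => RS p (restr S z)), if_pos (mem_univ _)]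
  congr 1
  ext j
  simp [restr]

lemma PsiB_thin (p b c : ℝ) (z : Fin n → X) :
    PsiB p (b * c) z = ∑ S : Fin n → Bool, bern b S * PsiB p c (restr S z) := by
  have h := push_prod (n := n) (fun a : Bool × Bool => (if a.1 then b else 1 - b) *
    (if a.2 then c else 1 - c)) (fun a => a.1 && a.2) (fun S => RS p (restr S z))
  have e1 : ∀ y : Bool, (∑ a : Bool × Bool, if (a.1 && a.2) = y then ((if a.1 then b else 1 - b) *
    (if a.2 then c else 1 - c)) else 0) = if y then b * c else 1 - b * c := by
    intro y
    rw [Fintype.sum_prod_type]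
    cases y <;> simp <;> ring
  simp only [e1] at h
  unfold PsiB
  unfold bern at *
  rw [← h, ← Equiv.sum_comp (Equiv.arrowProdEquivProdArrow (Fin n) (fun _ => Bool) (fun _ => Bool)).symm,
    Fintype.sum_prod_type]
  refine Finset.sum_congr rfl fun S _ => ?_
  rw [Finset.mul_sum]
  refine Finset.sum_congr rfl fun S' _ => ?_
  simp only [Equiv.arrowProdEquivProdArrow, Equiv.coe_fn_symm_mk, Finset.prod_mul_distrib]
  rw [mul_assoc]
  congr 3
  ext j
  simp only [restr, smul_smul]
  congr 1
  by_cases h1 : S j = true <;> by_cases h2 : S' j = true <;> simp [h1, h2]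

lemma PsiB_mono {p : ℝ} (hp : 1 < p) {b b' : ℝ} (h0 : 0 ≤ b') (hb : b' ≤ b) (h1 : b ≤ 1)
    (hb0 : 0 < b) (z : Fin n → X) : PsiB p b' z ≤ PsiB p b z := by
  have e : b' = b * (b' / b) := by field_simp
  rw [e, PsiB_thin]
  refine Finset.sum_le_sum fun S _ => mul_le_mul_of_nonneg_left ?_ (bern_nonneg hb0.le h1 S)
  unfold PsiB
  have hc0 : 0 ≤ b' / b := by positivity
  have hc1 : b' / b ≤ 1 := (div_le_one hb0).2 hb
  calc _ ≤ ∑ S' : Fin n → Bool, bern (b' / b) S' * RS p (restr S z) :=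
        Finset.sum_le_sum fun S' _ => mul_le_mul_of_nonneg_left (RS_restr hp _ _)
          (bern_nonneg hc0 hc1 S')
    _ = _ := by rw [← Finset.sum_mul, bern_sum, one_mul]

lemma star_labels {M : ℕ} (hM : 1 ≤ M) {p : ℝ} (hp : 1 < p) (hX : StarP X M p) (z : Fin n → X)
    (l : Fin n → (Fin M → Bool)) :
    ∑ θ : Fin M → Bool, RS p (restr (fun j => decide (l j = θ)) z) ≤
      2 ^ M * ((1 / 2) ^ p * RS p z) := by
  have hM0 : (0:ℝ) < M := by exact_mod_cast hM
  have h1 : ∀ θ : Fin M → Bool, (M:ℝ) ^ p * RS p (restr (fun j => decide (l j = θ)) z) ≤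
      RS p (fun j => (∑ i, rad (θ i) * rad (l j i)) • z j) := by
    intro θ
    rw [← RS_smul p M hM0.le]
    refine le_trans (le_of_eq ?_) (RS_contract hp (fun j => if l j = θ then (1:ℝ) else 0)
      (fun j => by split_ifs <;> simp) _)
    congr 1
    ext j
    simp only [restr, smul_smul]
    congr 1
    by_cases h : l j = θ
    · simp [h, rad_mul_self]
    · simp [h]
  have h2 : ∑ θ : Fin M → Bool, RS p (fun j => (∑ i, rad (θ i) * rad (l j i)) • z j) ≤
      2 ^ M * ((1 / 2) ^ p * (M : ℝ) ^ p * RS p z) := by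
    calc _ = ∑ δ : Fin n → Bool, ∑ θ : Fin M → Bool,
          ‖∑ i, rad (θ i) • ∑ j, rad (δ j) • rad (l j i) • z j‖ ^ p := by
          unfold RS
          rw [Finset.sum_comm]
          refine Finset.sum_congr rfl fun δ _ => Finset.sum_congr rfl fun θ _ => ?_
          congr 2
          simp only [Finset.smul_sum, Finset.sum_smul]
          rw [Finset.sum_comm]
          refine Finset.sum_congr rfl fun i _ => Finset.sum_congr rfl fun j _ => ?_
          simp only [smul_smul]
          congr 1; ring
      _ ≤ ∑ δ : Fin n → Bool, 2 ^ M * ((1 / 2) ^ p * (M : ℝ) ^ (p - 1) *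
          ∑ i, ‖∑ j, rad (δ j) • rad (l j i) • z j‖ ^ p) := by
          refine Finset.sum_le_sum fun δ _ => ?_
          have := hX (fun i => ∑ j, rad (δ j) • rad (l j i) • z j)
          rw [cubeAvg, smul_eq_mul, inv_mul_le_iff₀ (by positivity)] at this
          exact this
      _ = 2 ^ M * ((1 / 2) ^ p * (M : ℝ) ^ (p - 1) * ∑ i, RS p (fun j => rad (l j i) • z j)) := by
          rw [← Finset.mul_sum, ← Finset.mul_sum, Finset.sum_comm]
          rfl
      _ = _ := by
          simp only [fun i => RS_sign p (fun j => l j i) z]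
          rw [Finset.sum_const, Finset.card_univ, Fintype.card_fin, nsmul_eq_mul,
            Real.rpow_sub_one hM0.ne']
          field_simp
  have h3 : (M:ℝ) ^ p * ∑ θ : Fin M → Bool, RS p (restr (fun j => decide (l j = θ)) z) ≤
      (M:ℝ) ^ p * (2 ^ M * ((1 / 2) ^ p * RS p z)) := by
    rw [Finset.mul_sum]
    refine (Finset.sum_le_sum fun θ _ => h1 θ).trans (h2.trans (le_of_eq (by ring)))
  exact le_of_mul_le_mul_left h3 (by positivity)

lemma PsiB_beta {M : ℕ} (hM : 1 ≤ M) {p : ℝ} (hp : 1 < p) (hX : StarP X M p) (z : Fin n → X) :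
    PsiB p (((2:ℝ) ^ M)⁻¹) z ≤ (1 / 2) ^ p * RS p z := by
  have h : ∀ θ : Fin M → Bool, PsiB p (((2:ℝ) ^ M)⁻¹) z =
      ∑ l : Fin n → (Fin M → Bool), (∏ _j : Fin n, ((2:ℝ) ^ M)⁻¹) *
        RS p (restr (fun j => decide (l j = θ)) z) := by
    intro θ
    have h := push_prod (n := n) (fun _ : Fin M → Bool => ((2:ℝ) ^ M)⁻¹) (fun a => decide (a = θ))
      (fun S => RS p (restr S z))
    rw [h]
    unfold PsiB bern
    refine Finset.sum_congr rfl fun S _ => ?_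
    congr 1
    refine Finset.prod_congr rfl fun j _ => ?_
    have hneg : ∑ a : Fin M → Bool, (if a = θ then (0:ℝ) else ((2:ℝ) ^ M)⁻¹) = 1 - ((2:ℝ) ^ M)⁻¹ := by
      have e : ∀ a : Fin M → Bool, (if a = θ then (0:ℝ) else ((2:ℝ) ^ M)⁻¹) =
        ((2:ℝ) ^ M)⁻¹ - (if a = θ then ((2:ℝ) ^ M)⁻¹ else 0) := by
        intro a; split_ifs <;> simp
      simp only [e, Finset.sum_sub_distrib]
      simp
    cases S j
    · simpa using hneg.symm
    · simp
  have hsum : (2:ℝ) ^ M * PsiB p (((2:ℝ) ^ M)⁻¹) z ≤ 2 ^ M * ((1 / 2) ^ p * RS p z) := by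
    calc (2:ℝ) ^ M * PsiB p (((2:ℝ) ^ M)⁻¹) z = ∑ θ : Fin M → Bool, PsiB p (((2:ℝ) ^ M)⁻¹) z := by simp
      _ = ∑ l : Fin n → (Fin M → Bool), (∏ _j : Fin n, ((2:ℝ) ^ M)⁻¹) *
        ∑ θ : Fin M → Bool, RS p (restr (fun j => decide (l j = θ)) z) := by
        rw [Finset.sum_congr rfl fun θ _ => h θ, Finset.sum_comm]
        simp only [Finset.mul_sum]
      _ ≤ ∑ l : Fin n → (Fin M → Bool), (∏ _j : Fin n, ((2:ℝ) ^ M)⁻¹) *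
          (2 ^ M * ((1 / 2) ^ p * RS p z)) := by
        refine Finset.sum_le_sum fun l _ => mul_le_mul_of_nonneg_left (star_labels hM hp hX z l) ?_
        positivity
      _ = _ := by
        rw [← Finset.sum_mul]
        have : ∑ l : Fin n → (Fin M → Bool), (∏ _j : Fin n, ((2:ℝ) ^ M)⁻¹) = 1 := by
          simp
        rw [this, one_mul]
  exact le_of_mul_le_mul_left hsum (by positivity)

lemma PsiB_pow {M : ℕ} (hM : 1 ≤ M) {p : ℝ} (hp : 1 < p) (hX : StarP X M p) (z : Fin n → X)
    (k : ℕ) : PsiB p ((((2:ℝ) ^ M)⁻¹) ^ k) z ≤ ((1 / 2) ^ p) ^ k * RS p z := by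
  induction k with
  | zero => simp [PsiB_one]
  | succ k ih =>
    rw [pow_succ, PsiB_thin]
    have hb0 : 0 ≤ (((2:ℝ) ^ M)⁻¹) ^ k := by positivity
    have hb1 : (((2:ℝ) ^ M)⁻¹) ^ k ≤ 1 := pow_le_one₀ (by positivity)
      (inv_le_one_of_one_le₀ (one_le_pow₀ (by norm_num)))
    calc _ ≤ ∑ S : Fin n → Bool, bern ((((2:ℝ) ^ M)⁻¹) ^ k) S * ((1 / 2) ^ p * RS p (restr S z)) :=
          Finset.sum_le_sum fun S _ => mul_le_mul_of_nonneg_left (PsiB_beta hM hp hX _)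
            (bern_nonneg hb0 hb1 S)
      _ = (1 / 2) ^ p * PsiB p ((((2:ℝ) ^ M)⁻¹) ^ k) z := by
          unfold PsiB; rw [Finset.mul_sum]
          refine Finset.sum_congr rfl fun S _ => by ring
      _ ≤ (1 / 2) ^ p * (((1 / 2) ^ p) ^ k * RS p z) := by gcongr
      _ = _ := by ring

lemma PsiB_decay {M : ℕ} (hM : 1 ≤ M) {p : ℝ} (hp : 1 < p) (hX : StarP X M p) (z : Fin n → X)
    (b : ℝ) (h0 : 0 < b) (h1 : b ≤ 1) :
    PsiB p b z ≤ (2 * b ^ (1 / (M:ℝ))) ^ p * RS p z := by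
  have hM0 : (0:ℝ) < M := by exact_mod_cast hM
  have hβ : (((2:ℝ) ^ M)⁻¹) < 1 := inv_lt_one_of_one_lt₀ (one_lt_pow₀ (by norm_num) (by omega))
  obtain ⟨k, hk1, hk2⟩ := exists_nat_pow_near_of_lt_one h0 h1 (by positivity : 0 < ((2:ℝ) ^ M)⁻¹) hβ
  have hb1 : (((2:ℝ) ^ M)⁻¹) ^ k ≤ 1 := pow_le_one₀ (by positivity) hβ.le
  refine (PsiB_mono hp h0.le hk2 hb1 (by positivity) z).trans ((PsiB_pow hM hp hX z k).trans ?_)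
  refine mul_le_mul_of_nonneg_right ?_ (RS_nonneg p z)
  rw [← Real.rpow_natCast, ← Real.rpow_mul (by norm_num), mul_comm p, Real.rpow_mul (by norm_num),
    Real.rpow_natCast]
  refine Real.rpow_le_rpow (by positivity) ?_ (by linarith)
  have h3 := Real.rpow_le_rpow (by positivity) hk1.le (by positivity : 0 ≤ 1 / (M:ℝ))
  have e : ((((2:ℝ) ^ M)⁻¹) ^ (k + 1)) ^ (1 / (M:ℝ)) = (1 / 2) ^ (k + 1) := by
    have : (((2:ℝ) ^ M)⁻¹) ^ (k + 1) = (((1:ℝ) / 2) ^ (k + 1)) ^ M := by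
      rw [← inv_pow, ← pow_mul, ← pow_mul, mul_comm M]; norm_num
    rw [this, one_div (M:ℝ), Real.pow_rpow_inv_natCast (by positivity) (by omega)]
  rw [e, pow_succ] at h3
  linarith

end Decay

section Assembly

variable {n : ℕ} {X : Type*} [NormedAddCommGroup X] [NormedSpace ℝ X]

/-- push-forward of product weights, coordinate-dependent version -/
lemma push_prod2 {α γ : Type*} [Fintype α] [Fintype γ] [DecidableEq γ] (w : Fin n → α → ℝ)
    (g : Fin n → α → γ) (Φ : (Fin n → γ) → ℝ) :
    ∑ l : Fin n → α, (∏ j, w j (l j)) * Φ (fun j => g j (l j)) =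
      ∑ y : Fin n → γ, (∏ j, ∑ a, if g j a = y j then w j a else 0) * Φ y := by
  have e : ∀ y : Fin n → γ, (∏ j, ∑ a, if g j a = y j then w j a else 0) =
      ∑ l : Fin n → α, ∏ j, (if g j (l j) = y j then w j (l j) else 0) := fun y =>
    Fintype.prod_sum (fun j a => if g j a = y j then w j a else 0)
  simp only [e, Finset.sum_mul]
  rw [Finset.sum_comm]
  refine Finset.sum_congr rfl fun l _ => ?_
  rw [Finset.sum_eq_single (fun j => g j (l j))]
  · simp
  · intro y _ hy
    obtain ⟨j, hj⟩ := Function.ne_iff.1 hy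
    rw [Finset.prod_eq_zero (mem_univ j) (by rw [if_neg]; exact fun h => hj h.symm), zero_mul]
  · simp

lemma avg_weight (S : Fin n → Bool) (Φ : (Fin n → Bool) → ℝ)
    (hΦ : ∀ ε, Φ (fun i => if S i then ε i else true) = Φ ε) :
    ∑ ε : Fin n → Bool, (∏ i, (if S i then 1 else 1 + rad (ε i))) * Φ ε = ∑ ε, Φ ε := by
  have h1 := push_prod2 (n := n) (fun i b => (if S i then 1 else 1 + rad b))
    (fun i b => if S i then b else true) Φ
  have h2 := push_prod2 (n := n) (fun _ _ => (1:ℝ))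
    (fun i b => if S i then b else true) Φ
  simp only [hΦ] at h1 h2
  rw [h1]
  simp only [Finset.prod_const_one, one_mul] at h2
  rw [h2]
  refine Finset.sum_congr rfl fun y _ => ?_
  congr 1
  refine Finset.prod_congr rfl fun i _ => ?_
  cases S i <;> cases y i <;> simp [rad] <;> norm_num

/-- the kernel of the conditional expectation -/
def kS (S : Fin n → Bool) (ε η : Fin n → Bool) : ℝ :=
  (2 ^ n : ℝ)⁻¹ * ∏ i, (if S i then 1 else 1 + rad (ε i) * rad (η i))

lemma kS_nonneg (S : Fin n → Bool) (ε η : Fin n → Bool) : 0 ≤ kS S ε η := by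
  refine mul_nonneg (by positivity) (Finset.prod_nonneg fun i _ => ?_)
  split_ifs
  · norm_num
  · rw [one_add_rad]; split_ifs <;> norm_num

lemma kS_row (S : Fin n → Bool) (ε : Fin n → Bool) : ∑ η, kS S ε η = 1 := by
  simp only [kS, ← Finset.mul_sum]
  rw [sum_cube_prod (fun i c => (if S i then 1 else 1 + rad (ε i) * rad c))]
  have : ∀ i, ((if S i then 1 else 1 + rad (ε i) * rad true) +
      (if S i then 1 else 1 + rad (ε i) * rad false)) = (2:ℝ) := by
    intro i; split_ifs
    · norm_num
    · simp [rad]; ring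
  simp only [this]; simp

/-- indicator of `A ∩ S = {j}` -/
def chi (j : Fin n) (S : Fin n → Bool) (A : Finset (Fin n)) : ℝ :=
  ∏ i, (if i ∈ A then (if i = j then (if S i then 1 else 0) else (if S i then 0 else 1))
    else (if i = j then 0 else 1))

lemma chi_kernel (j : Fin n) (S ε η : Fin n → Bool) :
    ∑ A : Finset (Fin n), chi j S A * (walshChar A ε * walshChar A η) =
      (if S j then 1 else 0) * (rad (ε j) * rad (η j)) *
        ∏ i, (if S i then 1 else 1 + rad (ε i) * rad (η i)) := by
  have h := sum_subsets_prod (fun i => (if i = j then (if S i then (1:ℝ) else 0) else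
    (if S i then 0 else 1)) * (rad (ε i) * rad (η i))) (fun i => if i = j then 0 else 1)
  have e1 : ∀ A : Finset (Fin n), chi j S A * (walshChar A ε * walshChar A η) =
      ∏ i, (if i ∈ A then (if i = j then (if S i then (1:ℝ) else 0) else
    (if S i then 0 else 1)) * (rad (ε i) * rad (η i)) else (if i = j then 0 else 1)) := by
    intro A
    rw [chi, walsh_prod, walsh_prod, ← Finset.prod_mul_distrib, ← Finset.prod_mul_distrib]
    refine Finset.prod_congr rfl fun i _ => ?_
    by_cases hi : i ∈ A <;> simp [hi]
  simp only [e1, h]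
  rw [← Finset.mul_prod_erase univ _ (mem_univ j), ← Finset.mul_prod_erase univ _ (mem_univ j)]
  have e2 : ∀ i ∈ univ.erase j, ((if i = j then (if S i then (1:ℝ) else 0) else
    (if S i then 0 else 1)) * (rad (ε i) * rad (η i)) + (if i = j then 0 else 1)) =
    (if S i then 1 else 1 + rad (ε i) * rad (η i)) := by
    intro i hi
    have hij : i ≠ j := Finset.ne_of_mem_erase hi
    by_cases h : S i = true
    · simp [hij, h]
    · simp [hij, h]; ring
  rw [Finset.prod_congr rfl e2]
  by_cases h : S j = true
  · simp [h]
  · simp [h]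

lemma chi_bern (j : Fin n) (b : ℝ) (A : Finset (Fin n)) :
    ∑ S : Fin n → Bool, bern b S * chi j S A = if j ∈ A then b * (1 - b) ^ (A.card - 1) else 0 := by
  have e : ∀ S : Fin n → Bool, bern b S * chi j S A =
      ∏ i, ((if S i then b else 1 - b) * (if i ∈ A then (if i = j then (if S i then 1 else 0) else
        (if S i then 0 else 1)) else (if i = j then 0 else 1))) := by
    intro S
    rw [bern, chi, ← Finset.prod_mul_distrib]
  simp only [e]
  rw [sum_cube_prod (fun i c => ((if c then b else 1 - b) * (if i ∈ A then (if i = j then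
    (if c then 1 else 0) else (if c then 0 else 1)) else (if i = j then 0 else 1))))]
  rw [← Finset.mul_prod_erase univ _ (mem_univ j)]
  by_cases hj : j ∈ A
  · have e2 : ∀ i ∈ univ.erase j, (((if true then b else 1 - b) * (if i ∈ A then (if i = j then
      (if true then 1 else 0) else (if true then 0 else 1)) else (if i = j then 0 else 1))) +
      ((if false then b else 1 - b) * (if i ∈ A then (if i = j then
      (if false then 1 else 0) else (if false then 0 else 1)) else (if i = j then 0 else 1)))) =
      if i ∈ A then 1 - b else 1 := by
      intro i hi
      have hij : i ≠ j := Finset.ne_of_mem_erase hi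
      by_cases h : i ∈ A <;> simp [hij, h]
    have e3 := Finset.prod_congr rfl e2
    have e4 : ∏ i ∈ univ.erase j, (if i ∈ A then 1 - b else 1) = (1 - b) ^ (A.card - 1) := by
      rw [Finset.prod_ite_mem, Finset.prod_const]
      congr 1
      rw [← Finset.card_erase_of_mem hj]
      congr 1
      ext i; simp
    refine (congrArg₂ (· * ·) (?_ : _ = b) (e3.trans e4)).trans (if_pos hj).symm
    simp [hj]
  · rw [if_neg hj]; simp [hj]

lemma sum_Z_bound {p : ℝ} (hp : 1 < p) (f : Fin n → (Fin n → Bool) → X) (S : Fin n → Bool) :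
    ∑ ε : Fin n → Bool, ‖∑ j, ∑ A : Finset (Fin n), (chi j S A * walshChar A ε) • wcoef (f j) A‖ ^ p ≤
      (2 ^ n : ℝ)⁻¹ * ∑ η, RS p (restr S (fun j => f j η)) := by
  have e1 : ∀ ε : Fin n → Bool, ∑ j, ∑ A : Finset (Fin n),
      (chi j S A * walshChar A ε) • wcoef (f j) A =
      ∑ η, kS S ε η • ∑ j, (rad (ε j) * rad (η j)) • restr S (fun j => f j η) j := by
    intro ε
    simp only [Finset.smul_sum]
    rw [Finset.sum_comm (γ := Fin n → Bool)]
    refine Finset.sum_congr rfl fun j _ => ?_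
    simp only [wcoef, cubeAvg, Finset.smul_sum]
    rw [Finset.sum_comm]
    refine Finset.sum_congr rfl fun η _ => ?_
    have h := chi_kernel j S ε η
    simp only [smul_smul, restr]
    rw [← Finset.sum_smul]
    congr 1
    have : ∑ A : Finset (Fin n), chi j S A * walshChar A ε * ((2 ^ n : ℝ)⁻¹ * walshChar A η) =
        (2 ^ n : ℝ)⁻¹ * ∑ A : Finset (Fin n), chi j S A * (walshChar A ε * walshChar A η) := by
      rw [Finset.mul_sum]; refine Finset.sum_congr rfl fun A _ => by ring
    rw [kS]
    rw [this, h]; ring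
  simp only [e1]
  calc _ ≤ ∑ ε : Fin n → Bool, ∑ η, kS S ε η *
        ‖∑ j, (rad (ε j) * rad (η j)) • restr S (fun j => f j η) j‖ ^ p := by
        refine Finset.sum_le_sum fun ε _ => ?_
        have h1 : ‖∑ η, kS S ε η • ∑ j, (rad (ε j) * rad (η j)) • restr S (fun j => f j η) j‖ ≤
            ∑ η, kS S ε η * ‖∑ j, (rad (ε j) * rad (η j)) • restr S (fun j => f j η) j‖ := by
          refine (norm_sum_le _ _).trans (le_of_eq (Finset.sum_congr rfl fun b _ => ?_))
          rw [norm_smul, Real.norm_of_nonneg (kS_nonneg _ _ _)]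
        refine (Real.rpow_le_rpow (norm_nonneg _) h1 (by linarith)).trans ?_
        exact Real.rpow_arith_mean_le_arith_mean_rpow univ _ _
          (fun b _ => kS_nonneg _ _ _) (kS_row S ε) (fun b _ => norm_nonneg _) hp.le
    _ = (2 ^ n : ℝ)⁻¹ * ∑ η, RS p (restr S (fun j => f j η)) := by
      rw [Finset.sum_comm, Finset.mul_sum]
      refine Finset.sum_congr rfl fun η _ => ?_
      rw [← Equiv.sum_comp (sgnEquiv η)]
      have h := avg_weight S (fun ε => ‖∑ j, rad (ε j) • restr S (fun j => f j η) j‖ ^ p) (by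
        intro ε
        congr 2
        refine Finset.sum_congr rfl fun j _ => ?_
        by_cases hj : S j = true <;> simp [hj, restr])
      rw [RS, ← h, Finset.mul_sum]
      refine Finset.sum_congr rfl fun ε _ => ?_
      have e2 : ∀ j, rad (sgnEquiv η ε j) * rad (η j) = rad (ε j) := by
        intro j
        simp only [sgnEquiv, Equiv.coe_fn_mk, rad_beq]
        rw [mul_assoc, rad_mul_self, mul_one]
      simp only [kS, e2]
      ring

end Assembly

section Final

variable {n : ℕ} {X : Type*} [NormedAddCommGroup X] [NormedSpace ℝ X]

lemma flipCoord_invol (j : Fin n) : Function.Involutive (flipCoord j) := by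
  intro ε
  ext i
  by_cases h : i = j
  · subst h; simp [flipCoord]
  · simp [flipCoord, h]

lemma walsh_flip (j : Fin n) (A : Finset (Fin n)) (ε : Fin n → Bool) :
    walshChar A (flipCoord j ε) = (if j ∈ A then -1 else 1) * walshChar A ε := by
  have h : ∀ i, rad (flipCoord j ε i) = (if i = j then -1 else 1) * rad (ε i) := by
    intro i
    by_cases h : i = j
    · subst h; cases hε : ε i <;> simp [flipCoord, rad, hε]
    · simp [flipCoord, h]
  simp only [walshChar, h, Finset.prod_mul_distrib]
  congr 1
  rw [Finset.prod_ite_eq']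

lemma wcoef_Dop (j : Fin n) (f : (Fin n → Bool) → X) (A : Finset (Fin n)) :
    wcoef (Dop j f) A = if j ∈ A then wcoef f A else 0 := by
  have h1 : ∑ ε, walshChar A ε • f (flipCoord j ε) =
      (if j ∈ A then (-1:ℝ) else 1) • ∑ ε, walshChar A ε • f ε := by
    rw [← Equiv.sum_comp (flipCoord_invol j).toPerm, Finset.smul_sum]
    refine Finset.sum_congr rfl fun ε _ => ?_
    simp only [Function.Involutive.coe_toPerm, walsh_flip, flipCoord_invol j ε, mul_smul]
  have h2 : ∑ ε, walshChar A ε • Dop j f ε =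
      (2:ℝ)⁻¹ • (∑ ε, walshChar A ε • f ε - ∑ ε, walshChar A ε • f (flipCoord j ε)) := by
    rw [← Finset.sum_sub_distrib, Finset.smul_sum]
    refine Finset.sum_congr rfl fun ε _ => ?_
    rw [Dop, smul_comm, smul_sub]
  simp only [wcoef, cubeAvg]
  rw [h2, h1]
  split_ifs with h
  · congr 1
    rw [neg_one_smul, sub_neg_eq_add, ← two_smul ℝ, smul_smul]; norm_num
  · simp

lemma lap_Dop (j : Fin n) (f : (Fin n → Bool) → X) (ε : Fin n → Bool) :
    lapPow (-1) (Dop j f) ε = ∑ A : Finset (Fin n),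
      (if j ∈ A then (A.card : ℝ)⁻¹ else 0) • walshChar A ε • wcoef f A := by
  rw [lapPow, Finset.sum_filter]
  refine Finset.sum_congr rfl fun A _ => ?_
  rw [wcoef_Dop, Real.rpow_neg_one]
  by_cases h : j ∈ A
  · have : A ≠ ∅ := Finset.ne_empty_of_mem h
    simp [h, this, mul_smul]
  · simp [h]

lemma int_pow (k : ℕ) : ∫ b in (0:ℝ)..1, (1 - b) ^ k = ((k:ℝ) + 1)⁻¹ := by
  rw [intervalIntegral.integral_comp_sub_left (fun x : ℝ => x ^ k) 1]
  simp

lemma jensen_norm {p : ℝ} (hp : 1 < p) {ι Y : Type*} [Fintype ι] [NormedAddCommGroup Y]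
    [NormedSpace ℝ Y] (w : ι → ℝ) (hw : ∀ i, 0 ≤ w i) (h1 : ∑ i, w i = 1) (z : ι → Y) :
    ‖∑ i, w i • z i‖ ^ p ≤ ∑ i, w i * ‖z i‖ ^ p := by
  have h : ‖∑ i, w i • z i‖ ≤ ∑ i, w i * ‖z i‖ := by
    refine (norm_sum_le _ _).trans (le_of_eq (Finset.sum_congr rfl fun b _ => ?_))
    rw [norm_smul, Real.norm_of_nonneg (hw _)]
  refine (Real.rpow_le_rpow (norm_nonneg _) h (by linarith)).trans ?_
  exact Real.rpow_arith_mean_le_arith_mean_rpow univ _ _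
    (fun b _ => hw b) h1 (fun b _ => norm_nonneg _) hp.le

lemma main_bound [CompleteSpace X] {M : ℕ} (hM : 1 ≤ M) {p : ℝ} (hp : 1 < p) (hX : StarP X M p)
    (f : Fin n → (Fin n → Bool) → X) (N : ℝ) (hN : 0 ≤ N)
    (hf : (2 ^ n : ℝ)⁻¹ * ∑ η, RS p (fun j => f j η) ≤ N ^ p) :
    ∑ ε : Fin n → Bool, ‖∑ j, lapPow (-1) (Dop j (f j)) ε‖ ^ p ≤ (2 * M * N) ^ p := by
  haveI := fact_ofReal hp
  have hp0 : 0 ≤ p := by linarith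
  have hM0 : (0:ℝ) < M := by exact_mod_cast hM
  let v : Fin n → Finset (Fin n) → PiLp (ENNReal.ofReal p) (fun _ : Fin n → Bool => X) :=
    fun j A => WithLp.toLp _ (fun ε => walshChar A ε • wcoef (f j) A)
  have hv : ∀ (c : Fin n → Finset (Fin n) → ℝ) (ε : Fin n → Bool),
      (∑ j, ∑ A, c j A • v j A) ε = ∑ j, ∑ A, c j A • walshChar A ε • wcoef (f j) A := by
    intro c ε
    simp [v]
  let H : ℝ → PiLp (ENNReal.ofReal p) (fun _ : Fin n → Bool => X) := fun b =>
    ∑ j, ∑ A : Finset (Fin n), (if j ∈ A then (1 - b) ^ (A.card - 1) else 0) • v j A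
  let g : PiLp (ENNReal.ofReal p) (fun _ : Fin n → Bool => X) :=
    ∑ j, ∑ A : Finset (Fin n), (if j ∈ A then (A.card : ℝ)⁻¹ else 0) • v j A
  have hcont : ∀ (j : Fin n) (A : Finset (Fin n)), Continuous fun b : ℝ =>
      (if j ∈ A then (1 - b) ^ (A.card - 1) else 0) • v j A := by
    intro j A
    split_ifs <;> fun_prop
  have hinteg : ∫ b in (0:ℝ)..1, H b = g := by
    simp only [H, g]
    rw [intervalIntegral.integral_finsetSum
      (fun j _ => (continuous_finsetSum _ fun A _ => hcont j A).intervalIntegrable _ _)]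
    refine Finset.sum_congr rfl fun j _ => ?_
    rw [intervalIntegral.integral_finsetSum (fun A _ => (hcont j A).intervalIntegrable _ _)]
    refine Finset.sum_congr rfl fun A _ => ?_
    rw [intervalIntegral.integral_smul_const]
    congr 1
    by_cases h : j ∈ A
    · have hc : 1 ≤ A.card := Finset.card_pos.2 ⟨j, h⟩
      simp only [h, if_true]
      rw [int_pow, Nat.cast_sub hc]; simp
    · simp [h]
  let Z : (Fin n → Bool) → PiLp (ENNReal.ofReal p) (fun _ : Fin n → Bool => X) := fun S =>
    ∑ j, ∑ A : Finset (Fin n), chi j S A • v j A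
  have hZ : ∀ b, b • H b = ∑ S, bern b S • Z S := by
    intro b
    simp only [H, Z, Finset.smul_sum, smul_smul]
    rw [Finset.sum_comm (γ := Fin n → Bool)]
    refine Finset.sum_congr rfl fun j _ => ?_
    rw [Finset.sum_comm]
    refine Finset.sum_congr rfl fun A _ => ?_
    rw [← Finset.sum_smul, chi_bern]
    split_ifs <;> simp
  have hZn : ∀ S, ‖Z S‖ ^ p ≤ (2 ^ n : ℝ)⁻¹ * ∑ η, RS p (restr S (fun j => f j η)) := by
    intro S
    rw [pilp_norm_rpow hp]
    refine le_trans (le_of_eq ?_) (sum_Z_bound hp f S)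
    refine Finset.sum_congr rfl fun ε _ => ?_
    simp only [Z, hv, smul_smul]
  have hH : ∀ b : ℝ, 0 < b → b ≤ 1 → ‖H b‖ ≤ 2 * N * b ^ (1 / (M:ℝ) - 1) := by
    intro b h0 h1
    have e1 : ‖b • H b‖ ^ p ≤ (2 * b ^ (1 / (M:ℝ)) * N) ^ p := by
      rw [hZ]
      calc _ ≤ ∑ S, bern b S * ‖Z S‖ ^ p :=
            jensen_norm hp _ (fun S => bern_nonneg h0.le h1 S) (bern_sum b) _
        _ ≤ ∑ S, bern b S * ((2 ^ n : ℝ)⁻¹ * ∑ η, RS p (restr S (fun j => f j η))) :=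
            Finset.sum_le_sum fun S _ => mul_le_mul_of_nonneg_left (hZn S) (bern_nonneg h0.le h1 S)
        _ = (2 ^ n : ℝ)⁻¹ * ∑ η, PsiB p b (fun j => f j η) := by
            simp only [PsiB, Finset.mul_sum]
            rw [Finset.sum_comm]
            refine Finset.sum_congr rfl fun η _ => Finset.sum_congr rfl fun S _ => by ring
        _ ≤ (2 ^ n : ℝ)⁻¹ * ∑ η, (2 * b ^ (1 / (M:ℝ))) ^ p * RS p (fun j => f j η) := by
            refine mul_le_mul_of_nonneg_left (Finset.sum_le_sum fun η _ => ?_) (by positivity)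
            exact PsiB_decay hM hp hX _ b h0 h1
        _ = (2 * b ^ (1 / (M:ℝ))) ^ p * ((2 ^ n : ℝ)⁻¹ * ∑ η, RS p (fun j => f j η)) := by
            rw [← Finset.mul_sum]; ring
        _ ≤ (2 * b ^ (1 / (M:ℝ))) ^ p * N ^ p :=
            mul_le_mul_of_nonneg_left hf (by positivity)
        _ = _ := (Real.mul_rpow (by positivity) hN).symm
    have e2 := (Real.rpow_le_rpow_iff (norm_nonneg _) (by positivity) (by linarith : 0 < p)).1 e1
    rw [norm_smul, Real.norm_of_nonneg h0.le] at e2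
    rw [Real.rpow_sub h0, Real.rpow_one, ← mul_div_assoc, le_div_iff₀ h0]
    linarith
  have hr : -1 < 1 / (M:ℝ) - 1 := by
    have : 0 < 1 / (M:ℝ) := by positivity
    linarith
  have hg : ‖g‖ ≤ 2 * M * N := by
    rw [← hinteg]
    have h := intervalIntegral.norm_integral_le_of_norm_le (μ := MeasureTheory.volume)
      (f := H) (g := fun b : ℝ => 2 * N * b ^ (1 / (M:ℝ) - 1)) (a := 0) (b := 1) zero_le_one
      (Filter.Eventually.of_forall fun b hb => hH b hb.1 hb.2)
      ((intervalIntegral.intervalIntegrable_rpow' hr).const_mul _)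
    refine h.trans (le_of_eq ?_)
    rw [intervalIntegral.integral_const_mul, integral_rpow (Or.inl hr)]
    rw [Real.zero_rpow (by simp; omega)]
    simp
    ring
  have h3 := Real.rpow_le_rpow (norm_nonneg _) hg hp0
  rw [pilp_norm_rpow hp] at h3
  refine le_trans (le_of_eq ?_) h3
  refine Finset.sum_congr rfl fun ε _ => ?_
  simp only [g, hv, lap_Dop]

end Final

theorem general_pisier_type.{u} (s p T : ℝ) (hs1 : 1 < s) (hs2 : s ≤ 2)
    (hp1 : 1 < p) (hT : 0 < T) :
    ∃ C : ℝ, ∀ (X : Type u) [NormedAddCommGroup X] [NormedSpace ℝ X] [CompleteSpace X],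
      HasTypeConst X s T →
      ∀ (n : ℕ) (F : (Fin n → Bool) → (Fin n → Bool) → X),
        (cubeAvg (fun ε =>
            ‖∑ j, lapPow (-1)
              (Dop j (fun ε' => cubeAvg (fun δ : Fin n → Bool => rad (δ j) • F ε' δ))) ε‖
            ^ p)) ^ (1 / p) ≤
          C * (cubeAvg (fun δ : Fin n → Bool => cubeAvg (fun ε =>
            ‖F ε δ‖ ^ p))) ^ (1 / p) := by
  obtain ⟨M, hM, hstar⟩ := star_of_type.{u} s p T hs1 hs2 hp1 hT
  obtain ⟨K, hK, hrad⟩ := rad_proj.{u} M hM p hp1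
  refine ⟨2 * M * K, fun X _ _ _ hX n F => ?_⟩
  have hS := hstar X hX
  have hp0 : 0 < p := by linarith
  set Q : ℝ := (2 ^ n : ℝ)⁻¹ * ∑ η, ∑ δ, ‖F η δ‖ ^ p with hQ
  have hQ0 : 0 ≤ Q := by positivity
  have hb := main_bound hM hp1 hS
    (fun j ε' => cubeAvg (fun δ : Fin n → Bool => rad (δ j) • F ε' δ)) (K * Q ^ (1 / p))
    (by positivity) (by
      rw [Real.mul_rpow hK.le (by positivity), ← Real.rpow_mul hQ0, one_div_mul_cancel hp0.ne',
        Real.rpow_one, hQ, mul_left_comm, Finset.mul_sum univ _ (K ^ p)]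
      refine mul_le_mul_of_nonneg_left (Finset.sum_le_sum fun η _ => ?_) (by positivity)
      exact hrad X hS n (F η))
  have e1 : cubeAvg (fun δ : Fin n → Bool => cubeAvg (fun ε => ‖F ε δ‖ ^ p)) =
      (2 ^ n : ℝ)⁻¹ * Q := by
    simp only [cubeAvg, smul_eq_mul, hQ]
    rw [← Finset.mul_sum, Finset.sum_comm]
  rw [e1]
  have h2 : (0:ℝ) ≤ (2 ^ n : ℝ)⁻¹ := by positivity
  have hC : (0:ℝ) ≤ 2 * M * (K * Q ^ (1 / p)) := by positivity
  calc _ ≤ ((2 ^ n : ℝ)⁻¹ * (2 * M * (K * Q ^ (1 / p))) ^ p) ^ (1 / p) := by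
        refine Real.rpow_le_rpow ?_ ?_ (by positivity)
        · exact smul_nonneg h2 (Finset.sum_nonneg fun _ _ => by positivity)
        · exact mul_le_mul_of_nonneg_left hb h2
    _ = _ := by
      rw [Real.mul_rpow h2 (by positivity), Real.mul_rpow h2 hQ0, ← Real.rpow_mul hC,
        mul_one_div_cancel hp0.ne', Real.rpow_one]
      ring

end
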